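/- arXiv:2406.12821 — 4 statements merged into one kernel-verified Lean document; each statement's English description precedes it below -/
import Mathlib

section
/- Let E ⊂ ℝ^d be non-empty and bounded. Then lim_{r→0} sup_{θ∈(0,1]} ( θ·s_E(r^θ) − θ·dim_UB E ) = 0. Consequently, for every 0 ≤ h ≤ d, limsup_{r→0} sup_{θ∈(0,1]} ( (1−θ)·h + θ·s_E(r^θ) ) = max{h, dim_UB E}. -/
open Set Metric Filter Topology MeasureTheory

noncomputable section

/-- Least number of open balls of radius `r` needed to cover `E`. -/
def coveringNumber {α : Type*} [PseudoMetricSpace α] (E : Set α) (r : ℝ) : ℕ :=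
  sInf {n : ℕ | ∃ t : Finset α, t.card = n ∧ E ⊆ ⋃ x ∈ t, Metric.ball x r}

/-- `s_E(r) = log N_r(E) / log (1/r)`. -/
def sFun {α : Type*} [PseudoMetricSpace α] (E : Set α) (r : ℝ) : ℝ :=
  Real.log (coveringNumber E r) / Real.log (1 / r)

/-- Lower box dimension. -/
def dimLB {α : Type*} [PseudoMetricSpace α] (E : Set α) : ℝ :=
  Filter.liminf (fun r => sFun E r) (nhdsWithin (0 : ℝ) (Set.Ioi 0))

/-- Upper box dimension. -/
def dimUB {α : Type*} [PseudoMetricSpace α] (E : Set α) : ℝ :=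
  Filter.limsup (fun r => sFun E r) (nhdsWithin (0 : ℝ) (Set.Ioi 0))

/-- Upper right Dini derivative. -/
def upperDini (g : ℝ → ℝ) (x : ℝ) : ℝ :=
  Filter.limsup (fun h => (g (x + h) - g x) / h) (nhdsWithin (0 : ℝ) (Set.Ioi 0))

/-- The class `𝒢(λ, α)`. -/
def GClass (lam alp : ℝ) : Set (ℝ → ℝ) :=
  {g | Continuous g ∧ (∀ x, g x ∈ Set.Icc lam alp) ∧
    ∀ x, upperDini g x ∈ Set.Icc (lam - g x) (alp - g x)}

/-- Asymptotic equivalence of two functions. -/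
def AsympEquiv (f g : ℝ → ℝ) : Prop :=
  Filter.Tendsto (fun x => f x - g x) Filter.atTop (nhds 0)

/-- `E` has covering class `g`. -/
def HasCoveringClass {α : Type*} [PseudoMetricSpace α] (E : Set α) (g : ℝ → ℝ) : Prop :=
  AsympEquiv (fun x => sFun E (Real.exp (-Real.exp x))) g

/-- Composition of the maps indexed by a finite word. -/
def compMaps {α : Type*} {I : Type*} (T : I → α → α) : List I → α → α
  | [] => id
  | i :: w => T i ∘ compMaps T w

/-- A conformal iterated function system on `ℝ^d` satisfying the open set condition
and the cone condition. -/
structure CIFS (d : ℕ) where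
  /-- the compact seed set -/
  X : Set (EuclideanSpace ℝ (Fin d))
  /-- the countable index set -/
  I : Type
  /-- the contractions -/
  S : I → EuclideanSpace ℝ (Fin d) → EuclideanSpace ℝ (Fin d)
  hXcompact : IsCompact X
  hXconn : IsConnected X
  hXint : (interior X).Nonempty
  hIcount : Countable I
  hInonempty : Nonempty I
  hSmaps : ∀ i, Set.MapsTo (S i) X X
  /-- the uniform contraction ratio -/
  c : ℝ
  hc0 : 0 < c
  hc1 : c < 1
  hcontr : ∀ i, ∀ x ∈ X, ∀ y ∈ X,
    (x ≠ y → 0 < dist (S i x) (S i y)) ∧ dist (S i x) (S i y) ≤ c * dist x y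
  /-- the open connected set on which the maps extend conformally -/
  V : Set (EuclideanSpace ℝ (Fin d))
  hVopen : IsOpen V
  hVbdd : Bornology.IsBounded V
  hVconn : IsConnected V
  hXV : X ⊆ V
  /-- the conformal extensions -/
  T : I → EuclideanSpace ℝ (Fin d) → EuclideanSpace ℝ (Fin d)
  hTagree : ∀ i, ∀ x ∈ X, T i x = S i x
  hTmaps : ∀ i, Set.MapsTo (T i) V V
  hTinj : ∀ i, Set.InjOn (T i) V
  /-- the Hölder exponent in `C^{1+ε}` -/
  eps : ℝ
  heps : 0 < eps
  hTdiff : ∀ i, ContDiffOn ℝ 1 (T i) V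
  hTholder : ∀ i, ∃ C : ℝ, 0 < C ∧ ∀ x ∈ V, ∀ y ∈ V,
    ‖fderiv ℝ (T i) x - fderiv ℝ (T i) y‖ ≤ C * ‖x - y‖ ^ eps
  hTconf : ∀ i, ∀ x ∈ V, IsConformalMap (fderiv ℝ (T i) x)
  /-- the bounded distortion constant -/
  K : ℝ
  hK : 1 ≤ K
  hBD : ∀ w : List I, ∀ x ∈ V, ∀ y ∈ V,
    ‖fderiv ℝ (compMaps T w) x‖ ≤ K * ‖fderiv ℝ (compMaps T w) y‖
  hOSCin : ∀ i, S i '' interior X ⊆ interior X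
  hOSCdisj : ∀ i j, i ≠ j → Disjoint (S i '' interior X) (S j '' interior X)
  hCone : ∃ κ : ℝ, 0 < κ ∧ ∀ x ∈ X, ∀ r : ℝ, 0 < r → r < 1 →
    ENNReal.ofReal (κ * r ^ d) ≤ volume (Metric.ball x r ∩ interior X)

/-- The limit set (attractor) of a CIFS. -/
def CIFS.limitSet {d : ℕ} (Φ : CIFS d) : Set (EuclideanSpace ℝ (Fin d)) :=
  ⋃ γ : ℕ → Φ.I, ⋂ n : ℕ, compMaps Φ.S (List.ofFn fun k : Fin (n + 1) => γ k) '' Φ.X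

/-- The set of fixed points of the maps of a CIFS. -/
def CIFS.fixedPoints {d : ℕ} (Φ : CIFS d) : Set (EuclideanSpace ℝ (Fin d)) :=
  {x | x ∈ Φ.X ∧ ∃ i, Φ.S i x = x}

/-- `ρ(w) = sup_{x ∈ X} ‖S'_w(x)‖`. -/
def CIFS.rho {d : ℕ} (Φ : CIFS d) (w : List Φ.I) : ℝ :=
  sSup ((fun x => ‖fderiv ℝ (compMaps Φ.T w) x‖) '' Φ.X)

/-- `Ψ(r, θ) = (1 - θ)·dim_H Λ + θ·s_F(r^θ)`. -/
def CIFS.Psi {d : ℕ} (Φ : CIFS d) (r θ : ℝ) : ℝ :=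
  (1 - θ) * (dimH Φ.limitSet).toReal + θ * sFun Φ.fixedPoints (r ^ θ)

/-- `ψ(r) = max_{θ ∈ [0,1]} Ψ(r,θ)` (which equals the supremum over `θ ∈ (0,1]`,
since `Ψ(r,0)` is defined as the limit of `Ψ(r,θ)` as `θ → 0⁺`). -/
def CIFS.psi {d : ℕ} (Φ : CIFS d) (r : ℝ) : ℝ :=
  sSup (Φ.Psi r '' Set.Ioc (0 : ℝ) 1)

/-- The interval `𝒟(h, s, t, α)`. -/
def Dset (h s t α : ℝ) : Set ℝ :=
  if t ≤ h then {h}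
  else Set.Icc (max h s) (h + (t - h) * (α - h) * s / (α * t - h * s))

/-- The quantity whose limit as `θ → 1⁻` is the quasi-Assouad dimension. -/
def quasiAssouadAux {α : Type*} [PseudoMetricSpace α] (E : Set α) (θ : ℝ) : ℝ :=
  sInf {t : ℝ | 0 ≤ t ∧ ∃ C : ℝ, 0 < C ∧ ∀ x ∈ E, ∀ r R : ℝ,
    0 < r → r ≤ R ^ (1 / θ) → R ^ (1 / θ) ≤ R → R < 1 →
    (coveringNumber (E ∩ Metric.ball x R) r : ℝ) ≤ C * (R / r) ^ t}

/-- The quasi-Assouad dimension. -/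
def dimqA {α : Type*} [PseudoMetricSpace α] (E : Set α) : ℝ :=
  Filter.limsup (quasiAssouadAux E) (nhdsWithin (1 : ℝ) (Set.Iio 1))

/-- The modified lower box dimension. -/
def dimLMB {α : Type*} [PseudoMetricSpace α] (K : Set α) : ℝ :=
  sInf {s : ℝ | ∃ C : ℕ → Set α, (K ⊆ ⋃ i, C i) ∧
    (∀ i, (C i).Nonempty ∧ Bornology.IsBounded (C i)) ∧ s = ⨆ i, dimLB (C i)}

/-- The unit cube `[0,1]^d`. -/
def unitCube (d : ℕ) : Set (EuclideanSpace ℝ (Fin d)) :=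
  {x | ∀ j, x j ∈ Set.Icc (0 : ℝ) 1}

/-- The basic similarity maps in the homogeneous Moran construction. -/
def moranMap (d : ℕ) (r : ℝ) (i : Fin d → Bool)
    (x : EuclideanSpace ℝ (Fin d)) : EuclideanSpace ℝ (Fin d) :=
  (EuclideanSpace.equiv (Fin d) ℝ).symm (fun j => r * x j + (if i j then 1 - r else 0))

/-- The `n`-th level of the homogeneous Moran construction. -/
def moranLevel (d : ℕ) : (ℕ → ℝ) → ℕ → Set (EuclideanSpace ℝ (Fin d))
  | _, 0 => unitCube d
  | r, n + 1 => ⋃ i : Fin d → Bool, moranMap d (r 1) i '' moranLevel d (fun k => r (k + 1)) n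

/-- The homogeneous Moran set `M(r)`. -/
def moranSet (d : ℕ) (r : ℕ → ℝ) : Set (EuclideanSpace ℝ (Fin d)) :=
  ⋂ n, moranLevel d r (n + 1)

/-- The Gauss map `x ↦ 1/x - ⌊1/x⌋`. -/
def gaussMap (x : ℝ) : ℝ := Int.fract (1 / x)

/-- The `n`-th partial quotient (continued fraction digit) of `x` (`n = 0` gives `b₁ = ⌊1/x⌋`). -/
def cfDigit (x : ℝ) (n : ℕ) : ℤ := ⌊1 / gaussMap^[n] x⌋

/-- The set of irrationals in `(0,1)` all of whose continued fraction digits lie in `I`. -/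
def cfSet (I : Set ℕ) : Set ℝ :=
  {x | x ∈ Set.Ioo (0 : ℝ) 1 ∧ Irrational x ∧ ∀ n : ℕ, ∃ b ∈ I, cfDigit x n = (b : ℤ)}


section CoveringNumber

variable {α : Type*} [PseudoMetricSpace α] {E : Set α} {r : ℝ}

lemma coveringNumber_le_card {t : Finset α} (h : E ⊆ ⋃ x ∈ t, Metric.ball x r) :
    coveringNumber E r ≤ t.card :=
  Nat.sInf_le ⟨t, rfl, h⟩

lemma TotallyBounded.exists_card_eq_coveringNumber (hE : TotallyBounded E) (hr : 0 < r) :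
    ∃ t : Finset α, t.card = coveringNumber E r ∧ E ⊆ ⋃ x ∈ t, Metric.ball x r := by
  obtain ⟨t, ht, hcov⟩ := Metric.totallyBounded_iff.1 hE r hr
  exact Nat.sInf_mem (s := {n : ℕ | ∃ t : Finset α, t.card = n ∧ E ⊆ ⋃ x ∈ t, Metric.ball x r})
    ⟨_, ht.toFinset, rfl, by simpa using hcov⟩

lemma TotallyBounded.coveringNumber_anti (hE : TotallyBounded E) {r' : ℝ} (hr : 0 < r)
    (hrr' : r ≤ r') : coveringNumber E r' ≤ coveringNumber E r := by
  obtain ⟨t, ht, hcov⟩ := hE.exists_card_eq_coveringNumber hr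
  rw [← ht]
  exact coveringNumber_le_card
    (hcov.trans (iUnion₂_mono fun x _ => Metric.ball_subset_ball hrr'))

lemma TotallyBounded.log_coveringNumber_anti (hE : TotallyBounded E) {r' : ℝ} (hr : 0 < r)
    (hrr' : r ≤ r') : Real.log (coveringNumber E r') ≤ Real.log (coveringNumber E r) := by
  rcases Nat.eq_zero_or_pos (coveringNumber E r') with h | h
  · rw [h]
    simpa using Real.log_natCast_nonneg _
  · exact Real.log_le_log (by exact_mod_cast h) (by exact_mod_cast hE.coveringNumber_anti hr hrr')

lemma sFun_nonneg (E : Set α) (hr : 0 < r) (hr1 : r ≤ 1) : 0 ≤ sFun E r :=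
  div_nonneg (Real.log_natCast_nonneg _) (Real.log_nonneg (one_le_one_div hr hr1))

lemma mul_sFun_rpow (E : Set α) (hr : 0 < r) {θ : ℝ} (hθ : 0 < θ) :
    θ * sFun E (r ^ θ) = Real.log (coveringNumber E (r ^ θ)) / Real.log (1 / r) := by
  have h : Real.log (1 / r ^ θ) = θ * Real.log (1 / r) := by
    simp [Real.log_rpow hr]
  rw [sFun, h, mul_div_assoc', mul_div_mul_left _ _ hθ.ne']

lemma eventually_mem_Ioo_nhdsGT_zero {a : ℝ} (ha : 0 < a) : ∀ᶠ r in 𝓝[>] (0 : ℝ), r ∈ Ioo 0 a :=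
  Ioo_mem_nhdsGT ha

lemma tendsto_log_one_div_nhdsGT_zero :
    Tendsto (fun r : ℝ => Real.log (1 / r)) (𝓝[>] 0) atTop := by
  simpa [Function.comp_def] using Real.tendsto_log_atTop.comp tendsto_inv_nhdsGT_zero

lemma isBoundedUnder_ge_sFun (E : Set α) :
    IsBoundedUnder (· ≥ ·) (𝓝[>] 0) fun r => sFun E r :=
  isBoundedUnder_of_eventually_ge (a := 0) <| by
    filter_upwards [eventually_mem_Ioo_nhdsGT_zero one_pos] with r hr
    exact sFun_nonneg E hr.1 hr.2.le

lemma dimUB_nonneg (hE : IsBoundedUnder (· ≤ ·) (𝓝[>] 0) fun r => sFun E r) : 0 ≤ dimUB E := by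
  refine le_limsup_of_frequently_le (Eventually.frequently ?_) hE
  filter_upwards [eventually_mem_Ioo_nhdsGT_zero one_pos] with r hr
  exact sFun_nonneg E hr.1 hr.2.le

/-- The bound `s_E(ρ) ≤ dim_UB E + ε` for small `ρ` is uniform along the curves `ρ = r ^ θ`
once it is weighted by `θ`. -/
lemma eventually_mul_sFun_rpow_le (hE : TotallyBounded E)
    (hbdd : IsBoundedUnder (· ≤ ·) (𝓝[>] 0) fun r => sFun E r) {ε : ℝ} (hε : 0 < ε) :
    ∀ᶠ r in 𝓝[>] (0 : ℝ), ∀ θ ∈ Ioc (0 : ℝ) 1, θ * sFun E (r ^ θ) ≤ θ * dimUB E + ε := by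
  have hev : ∀ᶠ r in 𝓝[>] (0 : ℝ), sFun E r < dimUB E + ε :=
    eventually_lt_of_limsup_lt (lt_add_of_pos_right (dimUB E) hε) hbdd
  obtain ⟨δ, hδ, hsδ⟩ := mem_nhdsGT_iff_exists_Ioo_subset.1 hev
  have hδ : 0 < δ := hδ
  have hlim : Tendsto (fun r : ℝ => Real.log (coveringNumber E (δ / 2)) / Real.log (1 / r))
      (𝓝[>] 0) (𝓝 0) := tendsto_const_nhds.div_atTop tendsto_log_one_div_nhdsGT_zero
  filter_upwards [eventually_mem_Ioo_nhdsGT_zero one_pos, hlim.eventually_le_const hε]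
    with r hr hrε θ hθ
  have hpos : 0 < r ^ θ := Real.rpow_pos_of_pos hr.1 θ
  rcases lt_or_ge (r ^ θ) δ with h | h
  · have hs : sFun E (r ^ θ) < dimUB E + ε := hsδ ⟨hpos, h⟩
    nlinarith [hθ.1, hθ.2]
  · have hlog : 0 ≤ Real.log (1 / r) := Real.log_nonneg (one_le_one_div hr.1 hr.2.le)
    calc θ * sFun E (r ^ θ) = Real.log (coveringNumber E (r ^ θ)) / Real.log (1 / r) :=
          mul_sFun_rpow E hr.1 hθ.1
      _ ≤ Real.log (coveringNumber E (δ / 2)) / Real.log (1 / r) := by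
          exact div_le_div_of_nonneg_right
            (hE.log_coveringNumber_anti (half_pos hδ) ((half_le_self hδ.le).trans h)) hlog
      _ ≤ ε := hrε
      _ ≤ θ * dimUB E + ε := le_add_of_nonneg_left (mul_nonneg hθ.1.le (dimUB_nonneg hbdd))

end CoveringNumber

lemma Bornology.IsBounded.totallyBounded {α : Type*} [PseudoMetricSpace α] [ProperSpace α]
    {s : Set α} (hs : Bornology.IsBounded s) : TotallyBounded s :=
  hs.isCompact_closure.totallyBounded.subset subset_closure

section NormedSpace

variable {F : Type*} [NormedAddCommGroup F] [NormedSpace ℝ F] [ProperSpace F]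

lemma exists_coveringNumber_half_le : ∃ M : ℕ, ∀ E : Set F, Bornology.IsBounded E →
    ∀ r : ℝ, 0 < r → coveringNumber E (r / 2) ≤ M * coveringNumber E r := by
  classical
  obtain ⟨u, -, hu⟩ := TotallyBounded.exists_card_eq_coveringNumber
    (Metric.isBounded_ball (x := (0 : F)) (r := 1)).totallyBounded (half_pos one_pos)
  refine ⟨u.card, fun E hE r hr => ?_⟩
  obtain ⟨t, ht, hcov⟩ := hE.totallyBounded.exists_card_eq_coveringNumber hr
  have hsub : E ⊆ ⋃ x ∈ Finset.image₂ (fun (v x : F) => x + r • v) u t,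
      Metric.ball x (r / 2) := by
    intro y hy
    obtain ⟨x, hx, hyx⟩ := mem_iUnion₂.1 (hcov hy)
    have hball : r⁻¹ • (y - x) ∈ Metric.ball (0 : F) 1 := by
      rw [mem_ball_zero_iff, norm_smul, norm_inv, Real.norm_of_nonneg hr.le, ← dist_eq_norm,
        inv_mul_lt_one₀ hr]
      exact hyx
    obtain ⟨v, hv, hyv⟩ := mem_iUnion₂.1 (hu hball)
    refine mem_iUnion₂.2 ⟨x + r • v, Finset.mem_image₂_of_mem hv hx, ?_⟩
    have hscale : y - (x + r • v) = r • (r⁻¹ • (y - x) - v) := by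
      rw [smul_sub, smul_inv_smul₀ hr.ne']
      abel
    rw [mem_ball_iff_norm] at hyv ⊢
    rw [hscale, norm_smul, Real.norm_of_nonneg hr.le]
    calc r * ‖r⁻¹ • (y - x) - v‖ < r * (1 / 2) := by gcongr
      _ = r / 2 := by ring
  calc coveringNumber E (r / 2) ≤ _ := coveringNumber_le_card hsub
    _ ≤ u.card * t.card := Finset.card_image₂_le _ _ _
    _ = u.card * coveringNumber E r := by rw [ht]

lemma Bornology.IsBounded.isBoundedUnder_le_sFun {E : Set F} (hE : Bornology.IsBounded E) :
    IsBoundedUnder (· ≤ ·) (𝓝[>] 0) fun r => sFun E r := by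
  obtain ⟨M, hM⟩ := exists_coveringNumber_half_le (F := F)
  have hpow : ∀ n : ℕ, coveringNumber E ((1 / 2) ^ n) ≤ (M + 1) ^ n * (coveringNumber E 1 + 1) := by
    intro n
    induction n with
    | zero => simp
    | succ n ih =>
      calc coveringNumber E ((1 / 2) ^ (n + 1)) = coveringNumber E ((1 / 2) ^ n / 2) := by
            congr 1
            ring
        _ ≤ M * coveringNumber E ((1 / 2) ^ n) := hM E hE _ (by positivity)
        _ ≤ (M + 1) * ((M + 1) ^ n * (coveringNumber E 1 + 1)) := Nat.mul_le_mul (by simp) ih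
        _ = (M + 1) ^ (n + 1) * (coveringNumber E 1 + 1) := by ring
  set A : ℝ := Real.log (M + 1) with hA
  set B : ℝ := Real.log (coveringNumber E 1 + 1) with hB
  have hA0 : 0 ≤ A := Real.log_nonneg (by simp)
  have hB0 : 0 ≤ B := Real.log_nonneg (by simp)
  have hlogpow (n : ℕ) : Real.log (coveringNumber E ((1 / 2) ^ n)) ≤ n * A + B := by
    have hM1 : (0 : ℝ) < M + 1 := by positivity
    have hN1 : (0 : ℝ) < coveringNumber E 1 + 1 := by positivity
    rcases Nat.eq_zero_or_pos (coveringNumber E ((1 / 2) ^ n)) with h | h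
    · rw [h]
      simp only [Nat.cast_zero, Real.log_zero]
      positivity
    · rw [hA, hB, ← Real.log_pow, ← Real.log_mul (by positivity) (by positivity)]
      exact Real.log_le_log (by exact_mod_cast h) (by exact_mod_cast hpow n)
  have hl2 : 0 < Real.log 2 := Real.log_pos one_lt_two
  refine isBoundedUnder_of_eventually_le (a := (1 / Real.log 2 + 1) * A + B) ?_
  filter_upwards [eventually_mem_Ioo_nhdsGT_zero one_pos,
    tendsto_log_one_div_nhdsGT_zero.eventually_ge_atTop 1] with r hr hL
  set L := Real.log (1 / r) with hLdef
  set n := ⌈L / Real.log 2⌉₊ with hn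
  have hnL : L ≤ n * Real.log 2 := (div_le_iff₀ hl2).1 (Nat.le_ceil _)
  have hnub : (n : ℝ) ≤ L / Real.log 2 + 1 := (Nat.ceil_lt_add_one (by positivity)).le
  have hrn : ((1 : ℝ) / 2) ^ n ≤ r := by
    rw [← Real.log_le_log_iff (by positivity) hr.1, Real.log_pow, one_div, Real.log_inv]
    have : L = - Real.log r := by rw [hLdef, one_div, Real.log_inv]
    linarith
  rw [sFun, div_le_iff₀ (by linarith)]
  calc Real.log (coveringNumber E r)
      ≤ Real.log (coveringNumber E ((1 / 2) ^ n)) :=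
        hE.totallyBounded.log_coveringNumber_anti (by positivity) hrn
    _ ≤ n * A + B := hlogpow n
    _ ≤ (L / Real.log 2 + 1 * L) * A + B * L := by
        gcongr
        · linarith
        · exact le_mul_of_one_le_right hB0 hL
    _ = ((1 / Real.log 2 + 1) * A + B) * L := by ring

end NormedSpace

/-- If `g ≤ f` on `(0, 1]` and `g` tends to `a` at `0`, then the supremum of `f` is at least `a`. -/
lemma le_sSup_image_Ioc_of_tendsto {f g : ℝ → ℝ} {a : ℝ} (hbdd : BddAbove (f '' Ioc 0 1))
    (hgf : ∀ θ ∈ Ioc (0 : ℝ) 1, g θ ≤ f θ) (hg : Tendsto g (𝓝[>] 0) (𝓝 a)) :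
    a ≤ sSup (f '' Ioc 0 1) := by
  refine le_of_tendsto hg ?_
  filter_upwards [eventually_mem_Ioo_nhdsGT_zero one_pos] with θ hθ
  have hθ' : θ ∈ Ioc (0 : ℝ) 1 := Ioo_subset_Ioc_self hθ
  exact (hgf θ hθ').trans (le_csSup hbdd (mem_image_of_mem f hθ'))

/-- `lim_{r→0} sup_{θ∈(0,1]} (θ·s_E(r^θ) - θ·dim_UB E) = 0`, and for every
`0 ≤ h ≤ d`, `limsup_{r→0} sup_{θ∈(0,1]} ((1-θ)h + θ·s_E(r^θ)) = max{h, dim_UB E}`. -/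
theorem small_r_regularity {d : ℕ} (hd : 1 ≤ d) (E : Set (EuclideanSpace ℝ (Fin d)))
    (hE : E.Nonempty) (hEb : Bornology.IsBounded E) :
    Filter.Tendsto
      (fun r => sSup ((fun θ => θ * sFun E (r ^ θ) - θ * dimUB E) '' Set.Ioc (0 : ℝ) 1))
      (nhdsWithin (0 : ℝ) (Set.Ioi 0)) (nhds 0) ∧
    ∀ h : ℝ, 0 ≤ h → h ≤ d →
      Filter.limsup
        (fun r => sSup ((fun θ => (1 - θ) * h + θ * sFun E (r ^ θ)) '' Set.Ioc (0 : ℝ) 1))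
        (nhdsWithin (0 : ℝ) (Set.Ioi 0)) = max h (dimUB E) := by
  have hT : TotallyBounded E := hEb.totallyBounded
  have hbdd := hEb.isBoundedUnder_le_sFun
  have hne : (Ioc (0 : ℝ) 1).Nonempty := nonempty_Ioc.2 one_pos
  have hnonneg : ∀ r ∈ Ioo (0 : ℝ) 1, ∀ θ ∈ Ioc (0 : ℝ) 1, 0 ≤ θ * sFun E (r ^ θ) :=
    fun r hr θ hθ => mul_nonneg hθ.1.le
      (sFun_nonneg E (Real.rpow_pos_of_pos hr.1 θ) (Real.rpow_le_one hr.1.le hr.2.le hθ.1.le))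
  refine ⟨?_, fun h _ _ => ?_⟩
  · refine tendsto_order.2 ⟨fun a ha => ?_, fun a ha => ?_⟩
    · filter_upwards [eventually_mem_Ioo_nhdsGT_zero one_pos,
        eventually_mul_sFun_rpow_le hT hbdd one_pos] with r hr hle
      refine ha.trans_le (le_sSup_image_Ioc_of_tendsto (g := fun θ => -(θ * dimUB E)) ⟨1, ?_⟩
        (fun θ hθ => by linarith [hnonneg r hr θ hθ]) ?_)
      · rintro _ ⟨θ, hθ, rfl⟩
        linarith [hle θ hθ]
      · exact tendsto_nhdsWithin_of_tendsto_nhds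
          (Continuous.tendsto' (by fun_prop) _ _ (by simp))
    · filter_upwards [eventually_mul_sFun_rpow_le hT hbdd (half_pos ha)] with r hle
      refine (csSup_le (hne.image _) ?_).trans_lt (half_lt_self ha)
      rintro _ ⟨θ, hθ, rfl⟩
      linarith [hle θ hθ]
  · have hupper : ∀ ε > 0, ∀ᶠ r in 𝓝[>] (0 : ℝ), max h (dimUB E) + ε ∈
        upperBounds ((fun θ => (1 - θ) * h + θ * sFun E (r ^ θ)) '' Ioc (0 : ℝ) 1) := by
      intro ε hε
      filter_upwards [eventually_mul_sFun_rpow_le hT hbdd hε] with r hle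
      rintro _ ⟨θ, hθ, rfl⟩
      have h1 := mul_le_mul_of_nonneg_left (le_max_left h (dimUB E)) (sub_nonneg.2 hθ.2)
      have h2 := mul_le_mul_of_nonneg_left (le_max_right h (dimUB E)) hθ.1.le
      linarith [hle θ hθ]
    have hlower : ∀ᶠ r in 𝓝[>] (0 : ℝ),
        h ≤ sSup ((fun θ => (1 - θ) * h + θ * sFun E (r ^ θ)) '' Ioc (0 : ℝ) 1) := by
      filter_upwards [eventually_mem_Ioo_nhdsGT_zero one_pos, hupper 1 one_pos] with r hr hub
      refine le_sSup_image_Ioc_of_tendsto (g := fun θ => (1 - θ) * h) ⟨_, hub⟩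
        (fun θ hθ => by linarith [hnonneg r hr θ hθ]) ?_
      exact tendsto_nhdsWithin_of_tendsto_nhds
        (Continuous.tendsto' (by fun_prop) _ _ (by simp))
    have hle : ∀ ε > 0, ∀ᶠ r in 𝓝[>] (0 : ℝ),
        sSup ((fun θ => (1 - θ) * h + θ * sFun E (r ^ θ)) '' Ioc (0 : ℝ) 1) ≤
          max h (dimUB E) + ε := fun ε hε => by
      filter_upwards [hupper ε hε] with r hub
      exact csSup_le (hne.image _) hub
    have hbdd' := isBoundedUnder_of_eventually_le (hle 1 one_pos)
    have hcobdd := (isBoundedUnder_of_eventually_ge hlower).isCoboundedUnder_le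
    refine le_antisymm (le_of_forall_pos_le_add fun ε hε => limsup_le_of_le hcobdd (hle ε hε))
      (max_le (le_limsup_of_frequently_le hlower.frequently hbdd') ?_)
    refine limsup_le_limsup ?_ (isBoundedUnder_ge_sFun E).isCoboundedUnder_le hbdd'
    filter_upwards [hupper 1 one_pos] with r hub
    exact le_csSup ⟨_, hub⟩ ⟨1, right_mem_Ioc.2 one_pos, by simp⟩

end
end

section
/- Let e : ℝ → ℝ be any function with lim_{x→∞} e(x) = 0, let z ∈ ℝ, let 0 ≤ λ ≤ α, and let f : ℝ → ℝ be any function such that for all x₀ ≥ z and all x ≥ 0: λ − (λ − f(x₀) + e(x₀))·exp(−x) ≤ f(x₀ + x) ≤ α − (α − f(x₀))·exp(−x) + e(x₀ + x). Then there exists g ∈ 𝒢(λ,α) such that f and g are asymptotically equivalent. -/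
open Set Metric Filter Topology MeasureTheory

noncomputable section

/-- An interpolation principle: if `ψ i ≤ φ j + k (a i - a j)` for a subadditive `k`, then some
function `G` with increments controlled by `k` satisfies `ψ i ≤ G (a i) ≤ φ i`. -/
theorem exists_between_of_subadditive {ι : Type*} [Nonempty ι] (a φ ψ : ι → ℝ) (k : ℝ → ℝ)
    (hk0 : k 0 = 0) (hk : ∀ u v, k (u + v) ≤ k u + k v)
    (h : ∀ i j, ψ i ≤ φ j + k (a i - a j)) :
    ∃ G : ℝ → ℝ, (∀ s t, G t ≤ G s + k (t - s)) ∧ ∀ i, ψ i ≤ G (a i) ∧ G (a i) ≤ φ i := by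
  have hbdd : ∀ t, BddBelow (range fun j => φ j + k (t - a j)) := by
    intro t
    obtain ⟨i⟩ := ‹Nonempty ι›
    refine ⟨ψ i - k (a i - t), ?_⟩
    rintro _ ⟨j, rfl⟩
    have h1 := h i j
    have h2 := hk (a i - t) (t - a j)
    rw [sub_add_sub_cancel] at h2
    dsimp only
    linarith
  refine ⟨fun t => ⨅ j, (φ j + k (t - a j)), ?_, ?_⟩
  · intro s t
    dsimp only
    rw [← sub_le_iff_le_add]
    refine le_ciInf fun j => ?_
    have h1 := ciInf_le (hbdd t) j
    have h2 := hk (t - s) (s - a j)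
    rw [sub_add_sub_cancel] at h2
    linarith
  · intro i
    refine ⟨le_ciInf fun j => h i j, ?_⟩
    have h1 := ciInf_le (hbdd (a i)) i
    simpa [hk0] using h1

theorem tendsto_one_sub_exp_neg_div :
    Tendsto (fun h : ℝ => (1 - Real.exp (-h)) / h) (𝓝[>] 0) (𝓝 1) := by
  have h : HasDerivAt (fun h : ℝ => 1 - Real.exp (-h)) 1 0 := by
    simpa using ((hasDerivAt_id (0 : ℝ)).neg.exp).const_sub 1
  have h1 := (hasDerivAt_iff_tendsto_slope.1 h).mono_left
    (nhdsWithin_mono 0 fun x (hx : 0 < x) => hx.ne')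
  refine h1.congr fun x => ?_
  simp [slope_def_field]

/-- If the difference quotients of `g` at `x` lie between multiples of `(1 - exp (-h)) / h`, then
the upper right Dini derivative lies between the coefficients. -/
theorem upperDini_mem_Icc {g : ℝ → ℝ} {x a b : ℝ}
    (h : ∀ h, 0 < h → a * (1 - Real.exp (-h)) ≤ g (x + h) - g x ∧
      g (x + h) - g x ≤ b * (1 - Real.exp (-h))) :
    upperDini g x ∈ Icc a b := by
  have ha : Tendsto (fun h : ℝ => a * ((1 - Real.exp (-h)) / h)) (𝓝[>] 0) (𝓝 a) := by
    simpa using tendsto_one_sub_exp_neg_div.const_mul a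
  have hb : Tendsto (fun h : ℝ => b * ((1 - Real.exp (-h)) / h)) (𝓝[>] 0) (𝓝 b) := by
    simpa using tendsto_one_sub_exp_neg_div.const_mul b
  have hle : (fun h : ℝ => a * ((1 - Real.exp (-h)) / h)) ≤ᶠ[𝓝[>] 0]
      fun h => (g (x + h) - g x) / h := by
    filter_upwards [self_mem_nhdsWithin] with t (ht : 0 < t)
    rw [← mul_div_assoc]
    exact div_le_div_of_nonneg_right (h t ht).1 ht.le
  have hge : (fun h => (g (x + h) - g x) / h) ≤ᶠ[𝓝[>] 0]
      fun h : ℝ => b * ((1 - Real.exp (-h)) / h) := by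
    filter_upwards [self_mem_nhdsWithin] with t (ht : 0 < t)
    rw [← mul_div_assoc]
    exact div_le_div_of_nonneg_right (h t ht).2 ht.le
  have hub : IsBoundedUnder (· ≤ ·) (𝓝[>] 0) fun h => (g (x + h) - g x) / h :=
    hb.isBoundedUnder_le.mono_le hge
  have hlb : IsBoundedUnder (· ≥ ·) (𝓝[>] 0) fun h => (g (x + h) - g x) / h :=
    ha.isBoundedUnder_ge.mono_ge hle
  constructor
  · rw [← ha.limsup_eq]
    exact limsup_le_limsup hle ha.isCoboundedUnder_le hub
  · rw [← hb.limsup_eq]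
    exact limsup_le_limsup hge hlb.isCoboundedUnder_le hb.isBoundedUnder_le

/-- A function on `ℝ` whose slopes lie in `[lam, alp]` and which vanishes at `0` yields an element
of `𝒢(lam, alp)`. -/
theorem exp_neg_mul_mem_GClass {lam alp : ℝ} {G : ℝ → ℝ} (hG0 : G 0 = 0)
    (hG : ∀ s t, s ≤ t → lam * (t - s) ≤ G t - G s ∧ G t - G s ≤ alp * (t - s)) :
    (fun x => Real.exp (-x) * G (Real.exp x)) ∈ GClass lam alp := by
  have hexp : ∀ x : ℝ, Real.exp (-x) * Real.exp x = 1 := fun x => by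
    rw [← Real.exp_add]; simp
  have hcont : Continuous G := by
    have hL : LipschitzWith (Real.toNNReal (max |lam| |alp|)) G := by
      refine LipschitzWith.of_le_add_mul _ fun x y => ?_
      rw [Real.coe_toNNReal _ (by positivity), Real.dist_eq]
      have hl := (neg_abs_le lam)
      have ha := le_abs_self alp
      have h1 := le_max_left |lam| |alp|
      have h2 := le_max_right |lam| |alp|
      rcases le_total x y with hxy | hxy
      · rw [abs_of_nonpos (a := x - y) (sub_nonpos.2 hxy)]
        have := (hG x y hxy).1
        nlinarith
      · rw [abs_of_nonneg (a := x - y) (sub_nonneg.2 hxy)]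
        have := (hG y x hxy).2
        nlinarith
    exact hL.continuous
  refine ⟨by fun_prop, fun x => ?_, fun x => upperDini_mem_Icc fun h hh => ?_⟩
  · have h1 := hG 0 (Real.exp x) (Real.exp_pos x).le
    rw [hG0, sub_zero, sub_zero] at h1
    have hp := Real.exp_pos (-x)
    have h2 := mul_le_mul_of_nonneg_left h1.1 hp.le
    have h3 := mul_le_mul_of_nonneg_left h1.2 hp.le
    exact ⟨by linear_combination h2 - lam * hexp x, by linear_combination h3 + alp * hexp x⟩
  · have h1 := hG (Real.exp x) (Real.exp (x + h)) (Real.exp_le_exp.2 (by linarith))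
    have hp := Real.exp_pos (-(x + h))
    have e1 := hexp (x + h)
    have e2 : Real.exp (-(x + h)) * Real.exp x = Real.exp (-h) := by
      rw [← Real.exp_add]; congr 1; ring
    have e3 : Real.exp (-(x + h)) = Real.exp (-x) * Real.exp (-h) := by
      rw [← Real.exp_add]; congr 1; ring
    have h2 := mul_le_mul_of_nonneg_left h1.1 hp.le
    have h3 := mul_le_mul_of_nonneg_left h1.2 hp.le
    have e4 : ∀ c : ℝ, Real.exp (-(x + h)) * (c * (Real.exp (x + h) - Real.exp x))
        = c * (1 - Real.exp (-h)) := fun c => by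
      linear_combination c * e1 - c * e2
    have e5 : Real.exp (-(x + h)) * (G (Real.exp (x + h)) - G (Real.exp x))
        = Real.exp (-(x + h)) * G (Real.exp (x + h))
          - Real.exp (-h) * (Real.exp (-x) * G (Real.exp x)) := by
      linear_combination (-G (Real.exp x)) * e3
    rw [e4, e5] at h2 h3
    constructor <;> dsimp only <;> linarith

/-- Approximate versions of the `𝒢(λ, α)` inequalities imply asymptotic
equivalence to an element of `𝒢(λ, α)`. -/
theorem approx_bound_asymp_equiv (e : ℝ → ℝ)
    (he : Filter.Tendsto e Filter.atTop (nhds 0)) (z lam alp : ℝ)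
    (h0 : 0 ≤ lam) (hla : lam ≤ alp) (f : ℝ → ℝ)
    (hf : ∀ x₀, z ≤ x₀ → ∀ x : ℝ, 0 ≤ x →
      lam - (lam - f x₀ + e x₀) * Real.exp (-x) ≤ f (x₀ + x) ∧
      f (x₀ + x) ≤ alp - (alp - f x₀) * Real.exp (-x) + e (x₀ + x)) :
    ∃ g ∈ GClass lam alp, AsympEquiv f g := by
  have hexp : ∀ x : ℝ, Real.exp (-x) * Real.exp x = 1 := fun x => by
    rw [← Real.exp_add]; simp
  have hscaled : ∀ x y, z ≤ x → x ≤ y →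
      lam * (Real.exp y - Real.exp x) + Real.exp x * (f x - e x) ≤ Real.exp y * f y ∧
      Real.exp y * (f y - e y) ≤ alp * (Real.exp y - Real.exp x) + Real.exp x * f x := by
    intro x y hx hxy
    obtain ⟨h1, h2⟩ := hf x hx (y - x) (by linarith)
    rw [add_sub_cancel] at h1 h2
    have hp := (Real.exp_pos y).le
    have e1 : Real.exp y * Real.exp (-(y - x)) = Real.exp x := by
      rw [← Real.exp_add]; congr 1; ring
    have h3 := mul_le_mul_of_nonneg_left h1 hp
    have h4 := mul_le_mul_of_nonneg_left h2 hp
    constructor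
    · linear_combination h3 + (lam - f x + e x) * e1
    · linear_combination h4 - (alp - f x) * e1
  obtain ⟨G, hGk, hG⟩ := exists_between_of_subadditive (ι := Ici z)
    (fun x => Real.exp x) (fun x => Real.exp x * f x) (fun x => Real.exp x * (f x - e x))
    (fun u => max (alp * u) (lam * u)) (by simp)
    (fun u v => max_le
      (by rw [mul_add]; exact add_le_add (le_max_left _ _) (le_max_left _ _))
      (by rw [mul_add]; exact add_le_add (le_max_right _ _) (le_max_right _ _)))
    (by
      rintro ⟨x, hx⟩ ⟨y, hy⟩
      dsimp only
      rcases le_total x y with hxy | hxy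
      · have := (hscaled x y hx hxy).1
        have := le_max_right (alp * (Real.exp x - Real.exp y)) (lam * (Real.exp x - Real.exp y))
        linarith
      · have := (hscaled y x hy hxy).2
        have := le_max_left (alp * (Real.exp x - Real.exp y)) (lam * (Real.exp x - Real.exp y))
        linarith)
  refine ⟨fun x => Real.exp (-x) * (G (Real.exp x) - G 0),
    exp_neg_mul_mem_GClass (G := fun t => G t - G 0) (by simp) fun s t hst => ?_, ?_⟩
  · have h1 := hGk s t
    have h2 := hGk t s
    rw [max_eq_left (by nlinarith)] at h1
    rw [max_eq_right (by nlinarith)] at h2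
    constructor <;> linarith
  · have hG0 : Tendsto (fun x => Real.exp (-x) * G 0) atTop (𝓝 0) := by
      simpa using Real.tendsto_exp_neg_atTop_nhds_zero.mul_const (G 0)
    have hbound : ∀ᶠ x in atTop, 0 ≤ f x - Real.exp (-x) * G (Real.exp x) ∧
        f x - Real.exp (-x) * G (Real.exp x) ≤ e x := by
      filter_upwards [eventually_ge_atTop z] with x hx
      obtain ⟨h1, h2⟩ := hG ⟨x, hx⟩
      have hp := (Real.exp_pos (-x)).le
      have h3 := mul_le_mul_of_nonneg_left h1 hp
      have h4 := mul_le_mul_of_nonneg_left h2 hp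
      dsimp only at h3 h4
      rw [← mul_assoc, hexp, one_mul] at h3 h4
      constructor <;> linarith
    have hlim := squeeze_zero' (hbound.mono fun _ h => h.1) (hbound.mono fun _ h => h.2) he
    have hsum := hlim.add hG0
    rw [add_zero] at hsum
    exact hsum.congr fun x => by ring

end
end

section
/- Let 0 ≤ λ ≤ α and let f ∈ 𝒢(0,α). Define g(x) = sup_{θ∈(0,1]} ( (1−θ)·λ + θ·f(x − log(1/θ)) ). Then g is the pointwise minimal element of 𝒢(λ,α) satisfying f ≤ g pointwise. Moreover, for every x ∈ ℝ, if D⁺g(x) ≠ λ − g(x) then g(x) = f(x) and D⁺g(x) = D⁺f(x). -/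
open Set Metric Filter Topology MeasureTheory

noncomputable section

/-- A continuous function whose growth to the right has slope at least `K` everywhere on an
interval grows with slope at least `K` on that interval. -/
theorem add_mul_le_of_eventually_right {χ : ℝ → ℝ} (hχ : Continuous χ) {p q K : ℝ} (hpq : p ≤ q)
    (h : ∀ x ∈ Ico p q, ∀ᶠ t in 𝓝[>] (0 : ℝ), χ x + K * t ≤ χ (x + t)) :
    χ p + K * (q - p) ≤ χ q := by
  have hclosed : IsClosed ({x | χ p + K * (x - p) ≤ χ x} ∩ Icc p q) :=
    (isClosed_le (by fun_prop) hχ).inter isClosed_Icc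
  have hsub : Icc p q ⊆ {x | χ p + K * (x - p) ≤ χ x} := by
    refine hclosed.Icc_subset_of_forall_exists_gt (by simp) ?_
    rintro x ⟨hx, hxI⟩ y hy
    have hy' : (0 : ℝ) < y - x := sub_pos.2 hy
    obtain ⟨t, ht, ht0, hty⟩ := ((h x hxI).and (Ioc_mem_nhdsGT hy')).exists
    refine ⟨x + t, ?_, by linarith, by linarith⟩
    simp only [mem_ofPred_eq] at hx ⊢
    linarith
  exact hsub (right_mem_Icc.2 hpq)

/-- A continuous function which at every point either takes smaller values arbitrarily close to
the right, or has right derivative `+∞`, is antitone. -/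
theorem antitone_of_frequently_lt_or_deriv_top {χ : ℝ → ℝ} (hχ : Continuous χ)
    (h : ∀ x, (∃ᶠ t in 𝓝[>] (0 : ℝ), χ (x + t) < χ x) ∨
      ∀ K : ℝ, ∀ᶠ t in 𝓝[>] (0 : ℝ), χ x + K * t ≤ χ (x + t)) :
    Antitone χ := by
  intro a b hab
  by_contra! hlt
  set δ : ℕ → ℝ := fun n => 1 / ((n : ℝ) + 1) with hδ
  have hδpos : ∀ n, 0 < δ n := fun n => Nat.one_div_pos_of_nat
  set A : ℕ × ℤ → Set ℝ := fun i =>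
    Icc (i.2 * δ i.1) ((i.2 + 1) * δ i.1) ∩
      {x | ∀ t ∈ Icc 0 (δ i.1), χ x + t ≤ χ (x + t)} with hA
  have hAcompact : ∀ i, IsCompact (A i) := by
    intro i
    refine isCompact_Icc.inter_right ?_
    simp only [ofPred_forall]
    exact isClosed_iInter fun t => isClosed_iInter fun _ => isClosed_le (by fun_prop) (by fun_prop)
  have hcover : ∀ c ∈ Ioo (χ a) (χ b), ∃ i, c ∈ χ '' A i := by
    rintro c ⟨hac, hcb⟩
    have hcomp : IsCompact (Icc a b ∩ {x | χ x ≤ c}) :=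
      isCompact_Icc.inter_right (isClosed_le hχ continuous_const)
    obtain ⟨x, ⟨⟨hax, hxb⟩, hxc⟩, hmax⟩ :=
      hcomp.exists_isGreatest ⟨a, ⟨le_rfl, hab⟩, hac.le⟩
    simp only [mem_ofPred_eq] at hxc
    have hxb' : x < b := lt_of_le_of_ne hxb (by rintro rfl; linarith)
    have hright : ∀ y, x < y → y ≤ b → c < χ y := by
      intro y hy hyb
      by_contra! hyc
      exact absurd (hmax ⟨⟨hax.trans hy.le, hyb⟩, hyc⟩) (not_le.2 hy)
    have hxc' : χ x = c := by
      refine le_antisymm hxc (ge_of_tendsto (hχ.continuousWithinAt (s := Ioi x) (x := x)) ?_)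
      filter_upwards [Ioc_mem_nhdsGT hxb'] with y hy using (hright y hy.1 hy.2).le
    have hder : ∀ᶠ t in 𝓝[>] (0 : ℝ), χ x + 1 * t ≤ χ (x + t) := by
      refine (h x).resolve_left ?_ 1
      rw [not_frequently]
      filter_upwards [Ioc_mem_nhdsGT (sub_pos.2 hxb')] with t ht
      have := hright (x + t) (by linarith [ht.1]) (by linarith [ht.2])
      linarith
    obtain ⟨u, hu, hus⟩ := mem_nhdsGT_iff_exists_Ioc_subset.1 hder
    obtain ⟨n, hn⟩ := exists_nat_one_div_lt (show (0 : ℝ) < u from hu)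
    refine ⟨(n, ⌊x / δ n⌋), x, ⟨⟨?_, ?_⟩, ?_⟩, hxc'⟩
    · exact (le_div_iff₀ (hδpos n)).1 (Int.floor_le _)
    · exact (div_le_iff₀ (hδpos n)).1 (Int.lt_floor_add_one _).le
    · rintro t ⟨ht0, htn⟩
      rcases ht0.eq_or_lt with rfl | ht0
      · simp
      · have := hus ⟨ht0, htn.trans hn.le⟩
        simpa using this
  obtain ⟨i, hi⟩ : ∃ i, (interior (χ '' A i)).Nonempty := by
    by_contra! hempty
    have hd : Dense (⋂ i, (χ '' A i)ᶜ) :=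
      dense_iInter_of_isOpen (fun i => ((hAcompact i).image hχ).isClosed.isOpen_compl)
        fun i => interior_eq_empty_iff_dense_compl.1 (hempty i)
    obtain ⟨c, hc, hc'⟩ := hd.inter_open_nonempty _ isOpen_Ioo (nonempty_Ioo.2 hlt)
    obtain ⟨i, hi⟩ := hcover c hc
    exact mem_iInter.1 hc' i hi
  obtain ⟨c, hc⟩ := hi
  obtain ⟨d, hcd, hsub⟩ : ∃ d, c < d ∧ Icc c d ⊆ χ '' A i := by
    have hc' : χ '' A i ∈ 𝓝[≥] c :=
      mem_nhdsWithin_of_mem_nhds (mem_interior_iff_mem_nhds.1 hc)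
    obtain ⟨d, hd, hds⟩ := mem_nhdsGE_iff_exists_Icc_subset.1 hc'
    exact ⟨d, hd, hds⟩
  have hmono : ∀ x ∈ A i, ∀ y ∈ A i, x ≤ y → χ x + (y - x) ≤ χ y := by
    intro x hx y hy hxy
    have h1 := hx.1.1
    have h2 := hy.1.2
    have := hx.2 (y - x) ⟨by linarith, by linarith⟩
    simpa using this
  obtain ⟨p, hpA, hp⟩ := hsub (left_mem_Icc.2 hcd.le)
  obtain ⟨q, hqA, hq⟩ := hsub (right_mem_Icc.2 hcd.le)
  have hpq : p < q := by
    by_contra! hqp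
    have := hmono q hqA p hpA hqp
    linarith
  have hIcc : Icc p q ⊆ A i := by
    rintro z ⟨hpz, hzq⟩
    obtain ⟨w, ⟨hwA, hwz⟩, hw⟩ :=
      ((hAcompact i).inter_right (isClosed_Iic (a := z))).exists_isGreatest ⟨p, hpA, hpz⟩
    obtain ⟨v, ⟨hvA, hzv⟩, hv⟩ :=
      ((hAcompact i).inter_right (isClosed_Ici (a := z))).exists_isLeast ⟨q, hqA, hzq⟩
    simp only [mem_Iic, mem_Ici] at hwz hzv
    rcases (hwz.trans hzv).eq_or_lt with hwv | hwv
    · rwa [le_antisymm (hwv ▸ hzv) hwz] at *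
    · exfalso
      have hpw : p ≤ w := hw ⟨hpA, hpz⟩
      have hvq : v ≤ q := hv ⟨hqA, hzq⟩
      have h1 := hmono p hpA w hwA hpw
      have h2 := hmono v hvA q hqA hvq
      have h3 := hmono w hwA v hvA hwv.le
      obtain ⟨s, hsA, hs⟩ := hsub (show (χ w + χ v) / 2 ∈ Icc c d from
        ⟨by linarith, by linarith⟩)
      rcases le_total s z with hsz | hzs
      · have hsw : s ≤ w := hw ⟨hsA, hsz⟩
        have := hmono s hsA w hwA hsw
        linarith
      · have hvs : v ≤ s := hv ⟨hsA, hzs⟩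
        have := hmono v hvA s hsA hvs
        linarith
  have htop : ∀ x ∈ A i, ∀ K : ℝ, ∀ᶠ t in 𝓝[>] (0 : ℝ), χ x + K * t ≤ χ (x + t) := by
    intro x hx
    refine (h x).resolve_left ?_
    rw [not_frequently]
    filter_upwards [Ioc_mem_nhdsGT (hδpos i.1)] with t ht
    have := hx.2 t ⟨ht.1.le, ht.2⟩
    linarith [ht.1]
  have hq' := add_mul_le_of_eventually_right hχ hpq.le (K := (d - c + 1) / (q - p))
    fun x hx => htop x (hIcc (Ico_subset_Icc_self hx)) _
  rw [div_mul_cancel₀ _ (sub_pos.2 hpq).ne'] at hq'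
  linarith

/-- A continuous function whose upper right Dini derivative is everywhere nonnegative or `-∞` is
monotone. -/
theorem monotone_of_dini_nonneg_or_bot {N : ℝ → ℝ} (hN : Continuous N)
    (h : ∀ x, (∀ ε > 0, ∃ᶠ t in 𝓝[>] (0 : ℝ), N x - ε * t < N (x + t)) ∨
      ∀ K : ℝ, ∀ᶠ t in 𝓝[>] (0 : ℝ), N (x + t) ≤ N x - K * t) :
    Monotone N := by
  have key : ∀ ε > 0, Antitone fun x => -N x - ε * x := by
    intro ε hε
    refine antitone_of_frequently_lt_or_deriv_top (by fun_prop) fun x => ?_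
    refine (h x).imp (fun hx => ?_) fun hx K => ?_
    · exact (hx ε hε).mono fun t ht => by linarith
    · exact (hx (K + ε)).mono fun t ht => by linarith
  intro a b hab
  have hlim : Tendsto (fun ε : ℝ => N b + ε * (b - a)) (𝓝[>] 0) (𝓝 (N b)) := by
    have : Continuous fun ε : ℝ => N b + ε * (b - a) := by fun_prop
    simpa using (this.tendsto 0).mono_left nhdsWithin_le_nhds
  refine ge_of_tendsto hlim ?_
  filter_upwards [self_mem_nhdsWithin] with ε hε
  have := key ε hε hab
  simp only at this
  linarith

/-- A real number below the real-valued `limsup` is exceeded frequently, unless the function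
tends to `-∞`. -/
theorem frequently_lt_or_eventually_le_of_lt_limsup {β : Type*} {l : Filter β} {u : β → ℝ} {L : ℝ}
    (hL : L ≤ limsup u l) :
    (∀ r < L, ∃ᶠ t in l, r < u t) ∨ ∀ K : ℝ, ∀ᶠ t in l, u t ≤ K := by
  by_cases hb : BddBelow {a | ∀ᶠ t in l, u t ≤ a}
  · refine Or.inl fun r hr => ?_
    by_contra hf
    rw [not_frequently] at hf
    rw [limsup_eq] at hL
    have := csInf_le hb (show r ∈ {a | ∀ᶠ t in l, u t ≤ a} from hf.mono fun t => not_lt.1)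
    linarith
  · refine Or.inr fun K => ?_
    rw [not_bddBelow_iff] at hb
    obtain ⟨a, ha, haK⟩ := hb K
    exact ha.mono fun t ht => ht.trans haK.le

/-- For `g` in `𝒢(lam, alp)`, the function `exp x * (g x - lam)` is monotone. -/
theorem monotone_exp_mul_sub_of_mem_GClass {lam alp : ℝ} {g : ℝ → ℝ} (hg : g ∈ GClass lam alp) :
    Monotone fun x => Real.exp x * (g x - lam) := by
  obtain ⟨hcont, hrange, hdini⟩ := hg
  refine monotone_of_dini_nonneg_or_bot (by fun_prop) fun x => ?_
  have hE := Real.exp_pos x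
  have hG : 0 ≤ g x - lam := sub_nonneg.2 (hrange x).1
  have hexp : ∀ t, Real.exp (x + t) = Real.exp x * Real.exp t := fun t => Real.exp_add x t
  refine (frequently_lt_or_eventually_le_of_lt_limsup (hdini x).1).imp
    (fun hx ε hε => ?_) fun hx K => ?_
  · set η := ε / (4 * Real.exp x) with hη
    have hηpos : 0 < η := by positivity
    have hηE : Real.exp x * η = ε / 4 := by rw [hη]; field_simp
    have hd : 0 < min 1 (η / (g x - lam + 1)) := by positivity
    refine ((hx (lam - g x - η) (by linarith)).and_eventually (Ioc_mem_nhdsGT hd)).mono ?_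
    rintro t ⟨ht, ht0, htd⟩
    rw [lt_div_iff₀ ht0] at ht
    have ht1 : t ≤ 1 := htd.trans (min_le_left _ _)
    have ht2 : t * (g x - lam + 1) ≤ η :=
      (le_div_iff₀ (by linarith)).1 (htd.trans (min_le_right _ _))
    have hG' : 0 ≤ g (x + t) - lam := sub_nonneg.2 (hrange _).1
    have h1 : (1 + t) * (g (x + t) - lam) ≤ Real.exp t * (g (x + t) - lam) :=
      mul_le_mul_of_nonneg_right (by linarith [Real.add_one_le_exp t]) hG'
    have h2 : (1 + t) * (g x - lam + (lam - g x - η) * t) < (1 + t) * (g (x + t) - lam) :=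
      mul_lt_mul_of_pos_left (by linarith) (by linarith)
    have h3 : g x - lam - 4 * η * t < Real.exp t * (g (x + t) - lam) := by
      have : t * (t * (g x - lam)) ≤ t * η := mul_le_mul_of_nonneg_left (by linarith) ht0.le
      have : t * (t * η) ≤ 1 * (t * η) := mul_le_mul_of_nonneg_right ht1 (by positivity)
      nlinarith [mul_pos ht0 hηpos]
    have h4 := mul_lt_mul_of_pos_left h3 hE
    simp only [hexp]
    calc Real.exp x * (g x - lam) - ε * t
        = Real.exp x * (g x - lam) - 4 * (Real.exp x * η) * t := by rw [hηE]; ring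
      _ = Real.exp x * (g x - lam - 4 * η * t) := by ring
      _ < _ := h4
      _ = _ := by ring
  · filter_upwards [hx (-(K / Real.exp x) - 2 * (alp - lam)), Ioc_mem_nhdsGT one_pos] with t ht ht0
    rw [div_le_iff₀ ht0.1] at ht
    have hG' : 0 ≤ g (x + t) - lam := sub_nonneg.2 (hrange _).1
    have hG'' : g (x + t) - lam ≤ alp - lam := by linarith [(hrange (x + t)).2]
    have h1 : Real.exp t - 1 ≤ 2 * t := by
      have := Real.abs_exp_sub_one_le (x := t) (by rw [abs_of_pos ht0.1]; exact ht0.2)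
      rw [abs_of_pos ht0.1] at this
      exact (le_abs_self _).trans this
    have h2 : (Real.exp t - 1) * (g (x + t) - lam) ≤ 2 * t * (alp - lam) :=
      mul_le_mul h1 hG'' hG' (by linarith [ht0.1])
    have h3 : Real.exp t * (g (x + t) - lam) ≤ g x - lam - K / Real.exp x * t := by linarith
    have h4 := mul_le_mul_of_nonneg_left h3 hE.le
    simp only [hexp]
    calc Real.exp x * Real.exp t * (g (x + t) - lam)
        = Real.exp x * (Real.exp t * (g (x + t) - lam)) := by ring
      _ ≤ _ := h4
      _ = _ := by field_simp

/-- If `M` is the running supremum of a continuous function, then `M` is continuous. -/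
theorem continuous_of_isLUB_image_Iic {F M : ℝ → ℝ} (hF : Continuous F)
    (hM : ∀ x, IsLUB (F '' Iic x) (M x)) : Continuous M := by
  have hle : ∀ x y, y ≤ x → F y ≤ M x := fun x y hy => (hM x).1 (mem_image_of_mem F hy)
  rw [Metric.continuous_iff]
  intro x ε hε
  obtain ⟨δ, hδ, hball⟩ := Metric.continuous_iff.1 hF x (ε / 4) (by linarith)
  have key : ∀ y ∈ Metric.ball x δ, ∀ y' ∈ Metric.ball x δ, M y' ≤ M y + ε / 2 := by
    intro y hy y' hy'
    refine (hM y').2 ?_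
    rintro _ ⟨z, hz, rfl⟩
    rcases le_or_gt z y with hzy | hyz
    · linarith [hle y z hzy]
    · have hz' : z ∈ Metric.ball x δ := by
        rw [Real.ball_eq_Ioo] at hy hy' ⊢
        exact ⟨hy.1.trans hyz, lt_of_le_of_lt hz hy'.2⟩
      have h1 := hball z hz'
      have h2 := hball y hy
      rw [Real.dist_eq, abs_lt] at h1 h2
      linarith [hle y y le_rfl]
  refine ⟨δ, hδ, fun y hy => ?_⟩
  have h1 := key x (Metric.mem_ball_self hδ) y hy
  have h2 := key y hy x (Metric.mem_ball_self hδ)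
  rw [Real.dist_eq, abs_lt]
  constructor <;> linarith

theorem tendsto_exp_neg_mul_slope (G : ℝ) :
    Tendsto (fun t : ℝ => (Real.exp (-t) * G - G) / t) (𝓝[>] 0) (𝓝 (-G)) := by
  have h : HasDerivAt (fun t : ℝ => Real.exp (-t) * G) (-G) 0 := by
    have := ((hasDerivAt_neg (0 : ℝ)).exp).mul_const G
    simpa using this
  have := h.tendsto_slope_zero_right
  refine this.congr fun t => ?_
  simp [div_eq_inv_mul]

/-- Let `exp x * (g x - lam)` be the running supremum of `exp y * (f y - lam)`. At each point
either the upper right Dini derivative of `g` is `lam - g x`, or `g` touches `f` there, and the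
eventual upper bounds of the difference quotients are at least `lam - g x` for `g` and agree
for `f` and `g` above that value. -/
theorem upperDini_eq_or_of_isLUB {lam : ℝ} {f g : ℝ → ℝ} (hf : Continuous f)
    (hlam : ∀ x, lam ≤ g x)
    (hM : ∀ x, IsLUB ((fun y => Real.exp y * (f y - lam)) '' Iic x)
      (Real.exp x * (g x - lam))) (x : ℝ) :
    upperDini g x = lam - g x ∨
      (g x = f x ∧
        (∀ a, (∀ᶠ t in 𝓝[>] (0 : ℝ), (g (x + t) - g x) / t ≤ a) → lam - g x ≤ a) ∧
        ∀ a, lam - g x < a →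
          ((∀ᶠ t in 𝓝[>] (0 : ℝ), (g (x + t) - g x) / t ≤ a) ↔
            ∀ᶠ t in 𝓝[>] (0 : ℝ), (f (x + t) - f x) / t ≤ a)) := by
  have hle : ∀ x y, y ≤ x → Real.exp y * (f y - lam) ≤ Real.exp x * (g x - lam) :=
    fun x y hy => (hM x).1 ⟨y, hy, rfl⟩
  have hfg : ∀ y, f y ≤ g y := fun y => by
    linarith [le_of_mul_le_mul_left (hle y y le_rfl) (Real.exp_pos y)]
  have hmono : ∀ t, 0 ≤ t → Real.exp (-t) * (g x - lam) ≤ g (x + t) - lam := by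
    intro t ht
    have h1 : Real.exp x * (g x - lam) ≤ Real.exp (x + t) * (g (x + t) - lam) := by
      refine (hM x).2 ?_
      rintro _ ⟨z, hz, rfl⟩
      exact hle (x + t) z (le_add_of_le_of_nonneg hz ht)
    have h2 := mul_le_mul_of_nonneg_left h1 (Real.exp_pos (-(x + t))).le
    rwa [← mul_assoc, ← mul_assoc, ← Real.exp_add, ← Real.exp_add, neg_add_cancel, Real.exp_zero,
      one_mul, show -(x + t) + x = -t by ring] at h2
  have hupper : ∀ t B, Real.exp (x + t) * (g (x + t) - lam) ≤ Real.exp (x + t) * B →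
      g (x + t) - lam ≤ B := fun t B h => le_of_mul_le_mul_left h (Real.exp_pos _)
  rcases (hfg x).lt_or_eq with hlt | heq
  · left
    have hnear : ∀ᶠ z in 𝓝 x, Real.exp z * (f z - lam) < Real.exp x * (g x - lam) := by
      have hc : Continuous fun z => Real.exp z * (f z - lam) := by fun_prop
      exact hc.tendsto x |>.eventually_lt_const
        (mul_lt_mul_of_pos_left (by linarith) (Real.exp_pos x))
    obtain ⟨δ, hδ, hball⟩ := Metric.eventually_nhds_iff.1 hnear
    have ht := tendsto_exp_neg_mul_slope (g x - lam)
    rw [neg_sub] at ht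
    refine (ht.congr' ?_).limsup_eq
    filter_upwards [Ioo_mem_nhdsGT hδ] with t ht
    have h1 : g (x + t) - lam ≤ Real.exp (-t) * (g x - lam) := by
      refine hupper t _ ?_
      rw [← mul_assoc, ← Real.exp_add, add_neg_cancel_right]
      refine (hM (x + t)).2 ?_
      rintro _ ⟨z, hz, rfl⟩
      rcases le_or_gt z x with hzx | hxz
      · exact hle x z hzx
      · refine (hball ?_).le
        rw [Real.dist_eq, abs_of_pos (sub_pos.2 hxz)]
        have : z ≤ x + t := hz
        linarith [ht.2]
    have h2 := hmono t ht.1.le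
    congr 1
    linarith
  · right
    refine ⟨heq.symm, fun a ha => ?_, fun a ha => ⟨fun h => ?_, fun h => ?_⟩⟩
    · rw [← neg_sub (g x)]
      refine le_of_tendsto (tendsto_exp_neg_mul_slope (g x - lam)) ?_
      filter_upwards [ha, self_mem_nhdsWithin] with t hta ht
      refine le_trans ?_ hta
      have := hmono t (le_of_lt ht)
      exact div_le_div_of_nonneg_right (by linarith) (le_of_lt ht)
    · filter_upwards [h, self_mem_nhdsWithin] with t hta ht
      refine le_trans ?_ hta
      rw [heq]
      exact div_le_div_of_nonneg_right (by linarith [hfg (x + t)]) (le_of_lt ht)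
    · set G := g x - lam with hG
      have hG0 : 0 ≤ G := sub_nonneg.2 (hlam x)
      have haG : 0 < a + G := by linarith
      obtain ⟨u, hu, hus⟩ := mem_nhdsGT_iff_exists_Ioc_subset.1 h
      have hd : 0 < min u ((a + G) / (|a| + 1)) :=
        lt_min hu (by positivity)
      filter_upwards [Ioo_mem_nhdsGT hd] with t ht
      have htu : t ≤ u := ht.2.le.trans (min_le_left _ _)
      have hta : t * (|a| + 1) ≤ a + G :=
        (le_div_iff₀ (by positivity)).1 (ht.2.le.trans (min_le_right _ _))
      have hcmp : ∀ s, 0 ≤ s → s ≤ t →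
          Real.exp (x + s) * (G + a * s) ≤ Real.exp (x + t) * (G + a * t) := by
        intro s hs hst
        have h1 : 0 ≤ G + a * t := by
          have := neg_abs_le a
          rcases le_or_gt 0 a with h | h
          · have := mul_nonneg h ht.1.le
            linarith
          · rw [abs_of_neg h] at hta
            nlinarith [ht.1]
        have h2 : (1 + (t - s)) * (G + a * t) ≤ Real.exp (t - s) * (G + a * t) :=
          mul_le_mul_of_nonneg_right (by linarith [Real.add_one_le_exp (t - s)]) h1
        have h3 : G + a * s ≤ (1 + (t - s)) * (G + a * t) := by
          have h4 : 0 ≤ a + G + a * t := by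
            have := neg_abs_le a
            nlinarith [ht.1]
          nlinarith [mul_nonneg (sub_nonneg.2 hst) h4]
        have h5 := mul_le_mul_of_nonneg_left (h3.trans h2) (Real.exp_pos (x + s)).le
        rwa [← mul_assoc, ← Real.exp_add, show x + s + (t - s) = x + t by ring] at h5
      have h1 : g (x + t) - lam ≤ G + a * t := by
        refine hupper t _ ((hM (x + t)).2 ?_)
        rintro _ ⟨z, hz, rfl⟩
        rcases le_or_gt z x with hzx | hxz
        · have h6 := hcmp 0 le_rfl ht.1.le
          simp only [add_zero, mul_zero] at h6
          exact (hle x z hzx).trans h6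
        · have hzt : z - x ≤ t := by
            have : z ≤ x + t := hz
            linarith
          have h6 := hcmp (z - x) (by linarith) hzt
          have h7 : (f (x + (z - x)) - f x) / (z - x) ≤ a :=
            hus ⟨sub_pos.2 hxz, hzt.trans htu⟩
          rw [div_le_iff₀ (sub_pos.2 hxz)] at h7
          rw [add_sub_cancel] at h6 h7
          refine le_trans (mul_le_mul_of_nonneg_left ?_ (Real.exp_pos z).le) h6
          rw [hG, ← heq]
          linarith
      rw [div_le_iff₀ ht.1]
      linarith

/-- After rescaling, the supremum over `θ ∈ (0, 1]` is a running supremum. -/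
theorem isLUB_exp_mul_sub {lam alp : ℝ} (hla : lam ≤ alp) {f g : ℝ → ℝ} (hf : ∀ x, f x ≤ alp)
    (hgdef : ∀ x, g x =
      sSup ((fun θ => (1 - θ) * lam + θ * f (x - Real.log (1 / θ))) '' Set.Ioc (0 : ℝ) 1))
    (x : ℝ) :
    g x ≤ alp ∧ IsLUB ((fun y => Real.exp y * (f y - lam)) '' Iic x)
      (Real.exp x * (g x - lam)) := by
  have hub : alp ∈ upperBounds
      ((fun θ => (1 - θ) * lam + θ * f (x - Real.log (1 / θ))) '' Set.Ioc (0 : ℝ) 1) := by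
    rintro _ ⟨θ, ⟨hθ0, hθ1⟩, rfl⟩
    have h1 := mul_le_mul_of_nonneg_left hla (sub_nonneg.2 hθ1)
    have h2 := mul_le_mul_of_nonneg_left (hf (x - Real.log (1 / θ))) hθ0.le
    simp only
    linarith
  have hlub := isLUB_csSup ((nonempty_Ioc.2 one_pos).image _) ⟨alp, hub⟩
  rw [← hgdef x] at hlub
  refine ⟨hlub.2 hub, ?_, fun B hB => ?_⟩
  · rintro _ ⟨y, hy, rfl⟩
    have hy' : y ≤ x := hy
    have h1 := hlub.1 ⟨Real.exp (y - x), ⟨Real.exp_pos _, Real.exp_le_one_iff.2 (by linarith)⟩, rfl⟩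
    simp only [one_div, Real.log_inv, Real.log_exp, sub_neg_eq_add, add_sub_cancel] at h1
    have h2 : Real.exp (y - x) * (f y - lam) ≤ g x - lam := by linarith
    have h3 := mul_le_mul_of_nonneg_left h2 (Real.exp_pos x).le
    rwa [← mul_assoc, ← Real.exp_add, add_sub_cancel] at h3
  · have h1 : g x ≤ lam + Real.exp (-x) * B := by
      refine hlub.2 ?_
      rintro _ ⟨θ, ⟨hθ0, hθ1⟩, rfl⟩
      have h2 : Real.exp (x + Real.log θ) * (f (x + Real.log θ) - lam) ≤ B :=
        hB ⟨_, add_le_of_nonpos_right (Real.log_nonpos hθ0.le hθ1), rfl⟩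
      have h3 := mul_le_mul_of_nonneg_left h2 (Real.exp_pos (-x)).le
      rw [← mul_assoc, ← Real.exp_add, neg_add_cancel_left, Real.exp_log hθ0] at h3
      simp only [one_div, Real.log_inv, sub_neg_eq_add]
      linarith
    have h2 := mul_le_mul_of_nonneg_left (sub_le_iff_le_add'.2 h1) (Real.exp_pos x).le
    rwa [← mul_assoc, ← Real.exp_add, add_neg_cancel, Real.exp_zero, one_mul] at h2

/-- The function
`g(x) = sup_{θ∈(0,1]} ((1-θ)λ + θ f(x - log(1/θ)))` is the pointwise minimal element of
`𝒢(λ, α)` dominating `f ∈ 𝒢(0, α)`; moreover wherever `D⁺g(x) ≠ λ - g(x)` one has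
`g(x) = f(x)` and `D⁺g(x) = D⁺f(x)`. -/
theorem minimal_majorant (lam alp : ℝ) (h0 : 0 ≤ lam) (hla : lam ≤ alp)
    (f : ℝ → ℝ) (hf : f ∈ GClass 0 alp) (g : ℝ → ℝ)
    (hgdef : ∀ x, g x =
      sSup ((fun θ => (1 - θ) * lam + θ * f (x - Real.log (1 / θ))) '' Set.Ioc (0 : ℝ) 1)) :
    (g ∈ GClass lam alp ∧ (∀ x, f x ≤ g x) ∧
      ∀ g' ∈ GClass lam alp, (∀ x, f x ≤ g' x) → ∀ x, g x ≤ g' x) ∧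
    ∀ x, upperDini g x ≠ lam - g x → g x = f x ∧ upperDini g x = upperDini f x := by
  obtain ⟨hfc, hfr, hfd⟩ := hf
  have hlub := isLUB_exp_mul_sub hla (fun x => (hfr x).2) hgdef
  have hM := fun x => (hlub x).2
  have hfg : ∀ x, f x ≤ g x := fun x => by
    have h1 := (hM x).1 ⟨x, le_refl x, rfl⟩
    linarith [le_of_mul_le_mul_left h1 (Real.exp_pos x)]
  have hlg : ∀ x, lam ≤ g x := by
    intro x
    have h1 : Tendsto (fun y => Real.exp y * (-lam)) atBot (𝓝 0) := by
      simpa using Real.tendsto_exp_atBot.mul_const (-lam)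
    have h2 : 0 ≤ Real.exp x * (g x - lam) := by
      refine le_of_tendsto h1 ?_
      filter_upwards [eventually_le_atBot x] with y hy
      refine le_trans ?_ ((hM x).1 ⟨y, hy, rfl⟩)
      exact mul_le_mul_of_nonneg_left (by linarith [(hfr y).1]) (Real.exp_pos y).le
    linarith [nonneg_of_mul_nonneg_right h2 (Real.exp_pos x)]
  have hgc : Continuous g := by
    have h1 := continuous_of_isLUB_image_Iic (by fun_prop) hM
    have h2 : g = fun x => lam + Real.exp (-x) * (Real.exp x * (g x - lam)) := by
      funext x
      rw [← mul_assoc, ← Real.exp_add, neg_add_cancel, Real.exp_zero]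
      ring
    rw [h2]
    exact continuous_const.add ((Real.continuous_exp.comp continuous_neg).mul h1)
  have hD := upperDini_eq_or_of_isLUB hfc hlg hM
  have hup : ∀ x a b, (∀ᶠ t in 𝓝[>] (0 : ℝ), (f (x + t) - f x) / t ≤ a) → a ≤ b →
      ∀ᶠ t in 𝓝[>] (0 : ℝ), (f (x + t) - f x) / t ≤ b :=
    fun x a b h hab => h.mono fun t ht => ht.trans hab
  refine ⟨⟨⟨hgc, fun x => ⟨hlg x, (hlub x).1⟩, fun x => ?_⟩, hfg, ?_⟩, fun x hx => ?_⟩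
  · have hga := (hlub x).1
    rcases hD x with h | ⟨hgf, hlow, hiff⟩
    · rw [h]
      exact ⟨le_rfl, by linarith⟩
    · have hfx := (hfd x).2
      unfold upperDini at hfx ⊢
      rw [limsup_eq] at hfx ⊢
      rcases eq_empty_or_nonempty
        {a | ∀ᶠ t in 𝓝[>] (0 : ℝ), (g (x + t) - g x) / t ≤ a} with hS | hS
      · rw [hS, Real.sInf_empty]
        exact ⟨by linarith [hlg x], by linarith⟩
      · refine ⟨le_csInf hS hlow, le_of_forall_gt_imp_ge_of_dense fun a ha => ?_⟩
        refine csInf_le ⟨_, hlow⟩ ((hiff a (by linarith)).2 ?_)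
        have hSf : {a | ∀ᶠ t in 𝓝[>] (0 : ℝ), (f (x + t) - f x) / t ≤ a}.Nonempty := by
          obtain ⟨b, hb : ∀ᶠ t in 𝓝[>] (0 : ℝ), (g (x + t) - g x) / t ≤ b⟩ := hS
          have hb' : b ≤ max b (lam - g x + 1) := le_max_left _ _
          refine ⟨max b (lam - g x + 1), (hiff _ ?_).1 (hb.mono fun t ht => ht.trans hb')⟩
          exact lt_of_lt_of_le (by linarith) (le_max_right _ _)
        obtain ⟨b, hb, hba⟩ := exists_lt_of_csInf_lt hSf (lt_of_le_of_lt hfx (by rwa [← hgf]))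
        exact hup x b a hb hba.le
  · intro g' hg' hfg' x
    have hmono := monotone_exp_mul_sub_of_mem_GClass hg'
    have h1 : Real.exp x * (g x - lam) ≤ Real.exp x * (g' x - lam) := by
      refine (hM x).2 ?_
      rintro _ ⟨y, hy, rfl⟩
      refine le_trans ?_ (hmono hy)
      exact mul_le_mul_of_nonneg_left (by linarith [hfg' y]) (Real.exp_pos y).le
    linarith [le_of_mul_le_mul_left h1 (Real.exp_pos x)]
  · obtain ⟨hgf, hlow, hiff⟩ := (hD x).resolve_left hx
    refine ⟨hgf, ?_⟩
    unfold upperDini at hx ⊢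
    rw [limsup_eq] at hx ⊢
    rw [limsup_eq]
    congr 1
    ext a
    simp only [mem_ofPred_eq]
    rcases lt_or_ge (lam - g x) a with ha | ha
    · exact hiff a ha
    · have hno : ¬ ∀ b, lam - g x < b →
          ∀ᶠ t in 𝓝[>] (0 : ℝ), (g (x + t) - g x) / t ≤ b := by
        intro hall
        refine hx (le_antisymm (le_of_forall_gt_imp_ge_of_dense fun b hb =>
          csInf_le ⟨_, hlow⟩ (hall b hb)) (le_csInf ⟨lam - g x + 1, hall _ (by linarith)⟩ hlow))
      constructor
      · intro h
        exact absurd (fun b hb => h.mono fun t ht => ht.trans (ha.trans hb.le)) hno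
      · intro h
        exact absurd (fun b hb => (hiff b hb).2 (hup x a b h (ha.trans hb.le))) hno

end
end

section
/- Let {S_i}_{i∈I} be a CIFS with finite index set I and limit set Λ, let ρ(w) := sup_{x∈X} ‖S'_w(x)‖ for finite words w, let ρ_min := min_{i∈I} ρ(i) > 0, and let K be the bounded distortion constant. For 0 < r < 1 set I(r) := { finite words w over I : r < ρ(w) ≤ r·K·ρ_min^{−1} }. Then for every s < dim_H Λ there is a constant c > 0 such that #I(r) ≥ c·r^{−s} for all 0 < r < 1. -/
open Set Metric Filter Topology MeasureTheory

noncomputable section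

theorem compMaps_append {α I : Type*} (T : I → α → α) (u v : List I) :
    compMaps T (u ++ v) = compMaps T u ∘ compMaps T v := by
  induction u with
  | nil => rfl
  | cons i u ih => simp only [List.cons_append, compMaps, ih, Function.comp_assoc]

/-- Precomposition with a conformal endomorphism scales operator norms. -/
theorem IsConformalMap.norm_comp_eq {E F : Type*} [NormedAddCommGroup E] [NormedSpace ℝ E]
    [FiniteDimensional ℝ E] [Nontrivial E] [NormedAddCommGroup F] [NormedSpace ℝ F]
    (A : E →L[ℝ] F) {B : E →L[ℝ] E} (hB : IsConformalMap B) : ‖A.comp B‖ = ‖A‖ * ‖B‖ := by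
  obtain ⟨c, -, li, rfl⟩ := hB
  have hli : A.comp li.toContinuousLinearMap =
      A.comp ((li.toLinearIsometryEquiv rfl).toContinuousLinearEquiv : E →L[ℝ] E) := by
    ext x
    simp
  rw [ContinuousLinearMap.comp_smul, norm_smul, norm_smul, hli,
    ContinuousLinearMap.opNorm_comp_linearIsometryEquiv, li.norm_toContinuousLinearMap]
  ring

namespace CIFS

variable {d : ℕ} (Φ : CIFS d)

theorem mapsTo_compMaps_S (w : List Φ.I) : MapsTo (compMaps Φ.S w) Φ.X Φ.X := by
  induction w with
  | nil => exact mapsTo_id _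
  | cons i w ih => exact (Φ.hSmaps i).comp ih

theorem mapsTo_compMaps_T (w : List Φ.I) : MapsTo (compMaps Φ.T w) Φ.V Φ.V := by
  induction w with
  | nil => exact mapsTo_id _
  | cons i w ih => exact (Φ.hTmaps i).comp ih

theorem compMaps_T_eq_S (w : List Φ.I) {x : EuclideanSpace ℝ (Fin d)} (hx : x ∈ Φ.X) :
    compMaps Φ.T w x = compMaps Φ.S w x := by
  induction w with
  | nil => rfl
  | cons i w ih =>
    simp only [compMaps, Function.comp_apply, ih]
    exact Φ.hTagree i _ (Φ.mapsTo_compMaps_S w hx)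

theorem differentiableAt_T (i : Φ.I) {x : EuclideanSpace ℝ (Fin d)} (hx : x ∈ Φ.V) :
    DifferentiableAt ℝ (Φ.T i) x :=
  ((Φ.hTdiff i).contDiffAt (Φ.hVopen.mem_nhds hx)).differentiableAt one_ne_zero

theorem differentiableAt_compMaps_T (w : List Φ.I) {x : EuclideanSpace ℝ (Fin d)}
    (hx : x ∈ Φ.V) : DifferentiableAt ℝ (compMaps Φ.T w) x := by
  induction w with
  | nil => exact differentiableAt_id
  | cons i w ih => exact (Φ.differentiableAt_T i (Φ.mapsTo_compMaps_T w hx)).comp x ih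

theorem dist_compMaps_S_le (w : List Φ.I) {x y : EuclideanSpace ℝ (Fin d)} (hx : x ∈ Φ.X)
    (hy : y ∈ Φ.X) :
    dist (compMaps Φ.S w x) (compMaps Φ.S w y) ≤ Φ.c ^ w.length * dist x y := by
  induction w with
  | nil => simp [compMaps]
  | cons i w ih =>
    calc _ ≤ Φ.c * dist (compMaps Φ.S w x) (compMaps Φ.S w y) :=
          (Φ.hcontr i _ (Φ.mapsTo_compMaps_S w hx) _ (Φ.mapsTo_compMaps_S w hy)).2
      _ ≤ Φ.c * (Φ.c ^ w.length * dist x y) := mul_le_mul_of_nonneg_left ih Φ.hc0.le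
      _ = Φ.c ^ (i :: w).length * dist x y := by rw [List.length_cons]; ring

theorem norm_fderiv_le_rho (w : List Φ.I) {x : EuclideanSpace ℝ (Fin d)} (hx : x ∈ Φ.X) :
    ‖fderiv ℝ (compMaps Φ.T w) x‖ ≤ Φ.rho w := by
  refine le_csSup ⟨Φ.K * ‖fderiv ℝ (compMaps Φ.T w) x‖, ?_⟩ (mem_image_of_mem _ hx)
  rintro _ ⟨y, hy, rfl⟩
  exact Φ.hBD w y (Φ.hXV hy) x (Φ.hXV hx)

theorem rho_le (w : List Φ.I) {M : ℝ}
    (hM : ∀ x ∈ Φ.X, ‖fderiv ℝ (compMaps Φ.T w) x‖ ≤ M) : Φ.rho w ≤ M :=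
  csSup_le (Φ.hXconn.nonempty.image _) (by rintro _ ⟨x, hx, rfl⟩; exact hM x hx)

theorem rho_le_mul_norm_fderiv (w : List Φ.I) {x : EuclideanSpace ℝ (Fin d)} (hx : x ∈ Φ.V) :
    Φ.rho w ≤ Φ.K * ‖fderiv ℝ (compMaps Φ.T w) x‖ :=
  Φ.rho_le w fun y hy => Φ.hBD w y (Φ.hXV hy) x hx

theorem K_pos : 0 < Φ.K := zero_lt_one.trans_le Φ.hK

theorem norm_fderiv_le_mul_rho (w : List Φ.I) {x : EuclideanSpace ℝ (Fin d)} (hx : x ∈ Φ.V) :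
    ‖fderiv ℝ (compMaps Φ.T w) x‖ ≤ Φ.K * Φ.rho w := by
  obtain ⟨y, hy⟩ := Φ.hXconn.nonempty
  exact (Φ.hBD w x hx y (Φ.hXV hy)).trans
    (mul_le_mul_of_nonneg_left (Φ.norm_fderiv_le_rho w hy) Φ.K_pos.le)

theorem rho_nonneg (w : List Φ.I) : 0 ≤ Φ.rho w := by
  obtain ⟨y, hy⟩ := Φ.hXconn.nonempty
  exact (norm_nonneg _).trans (Φ.norm_fderiv_le_rho w hy)

theorem rho_le_mul_pow (w : List Φ.I) : Φ.rho w ≤ Φ.K * Φ.c ^ w.length := by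
  obtain ⟨x, hx⟩ := Φ.hXint
  have hxX := interior_subset hx
  refine (Φ.rho_le_mul_norm_fderiv w (Φ.hXV hxX)).trans
    (mul_le_mul_of_nonneg_left ?_ Φ.K_pos.le)
  refine norm_fderiv_le_of_lip' ℝ (pow_nonneg Φ.hc0.le _) ?_
  filter_upwards [mem_interior_iff_mem_nhds.1 hx] with y hy
  rw [Φ.compMaps_T_eq_S w hy, Φ.compMaps_T_eq_S w hxX, ← dist_eq_norm, ← dist_eq_norm]
  exact Φ.dist_compMaps_S_le w hy hxX

theorem rho_nil [Nontrivial (EuclideanSpace ℝ (Fin d))] : Φ.rho [] = 1 := by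
  have h : (fun x => ‖fderiv ℝ (compMaps Φ.T []) x‖) '' Φ.X = {1} := by
    simp only [compMaps, fderiv_id, ContinuousLinearMap.norm_id]
    exact Φ.hXconn.nonempty.image_const 1
  rw [rho, h, csSup_singleton]

theorem rho_singleton_pos [Nontrivial (EuclideanSpace ℝ (Fin d))] (i : Φ.I) :
    0 < Φ.rho [i] := by
  obtain ⟨x, hx⟩ := Φ.hXconn.nonempty
  exact (norm_pos_iff.2 (Φ.hTconf i x (Φ.hXV hx)).ne_zero).trans_le (Φ.norm_fderiv_le_rho [i] hx)

theorem rho_mul_rho_le [Nontrivial (EuclideanSpace ℝ (Fin d))] (w : List Φ.I) (i : Φ.I) :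
    Φ.rho w * Φ.rho [i] ≤ Φ.K * Φ.rho (w ++ [i]) := by
  obtain h | h := (Φ.rho_nonneg w).eq_or_lt
  · rw [← h, zero_mul]
    exact mul_nonneg Φ.K_pos.le (Φ.rho_nonneg _)
  rw [mul_comm, ← le_div_iff₀ h]
  refine Φ.rho_le _ fun x hx => ?_
  rw [le_div_iff₀ h, mul_comm]
  have hx' := Φ.hXV hx
  have hTx : Φ.T i x ∈ Φ.V := Φ.hTmaps i hx'
  have hcomp : ‖fderiv ℝ (compMaps Φ.T (w ++ [i])) x‖ =
      ‖fderiv ℝ (compMaps Φ.T w) (Φ.T i x)‖ * ‖fderiv ℝ (Φ.T i) x‖ := by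
    rw [compMaps_append]
    change ‖fderiv ℝ (compMaps Φ.T w ∘ Φ.T i) x‖ = _
    rw [fderiv_comp x (Φ.differentiableAt_compMaps_T w hTx) (Φ.differentiableAt_T i hx'),
      (Φ.hTconf i x hx').norm_comp_eq]
  calc Φ.rho w * ‖fderiv ℝ (Φ.T i) x‖
      ≤ Φ.K * ‖fderiv ℝ (compMaps Φ.T w) (Φ.T i x)‖ * ‖fderiv ℝ (Φ.T i) x‖ :=
        mul_le_mul_of_nonneg_right (Φ.rho_le_mul_norm_fderiv w hTx) (norm_nonneg _)
    _ = Φ.K * ‖fderiv ℝ (compMaps Φ.T (w ++ [i])) x‖ := by rw [hcomp, mul_assoc]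
    _ ≤ Φ.K * Φ.rho (w ++ [i]) :=
        mul_le_mul_of_nonneg_left (Φ.norm_fderiv_le_rho _ hx) Φ.K_pos.le

/-- Every point of `V` has a neighbourhood on which each `T_w` is Lipschitz with a constant
comparable to `ρ(w)`. -/
theorem exists_ball_dist_compMaps_T_le {x : EuclideanSpace ℝ (Fin d)} (hx : x ∈ Φ.V) :
    ∃ ε > 0, ∀ y ∈ ball x ε, ∀ w : List Φ.I,
      dist (compMaps Φ.T w y) (compMaps Φ.T w x) ≤ Φ.K * ε * Φ.rho w := by
  obtain ⟨ε, hε, hball⟩ := Metric.isOpen_iff.1 Φ.hVopen x hx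
  refine ⟨ε, hε, fun y hy w => ?_⟩
  rw [dist_eq_norm]
  calc ‖compMaps Φ.T w y - compMaps Φ.T w x‖ ≤ Φ.K * Φ.rho w * ‖y - x‖ :=
        (convex_ball x ε).norm_image_sub_le_of_norm_fderiv_le
          (fun z hz => Φ.differentiableAt_compMaps_T w (hball hz))
          (fun z hz => Φ.norm_fderiv_le_mul_rho w (hball hz)) (mem_ball_self hε) hy
    _ ≤ Φ.K * Φ.rho w * ε :=
        mul_le_mul_of_nonneg_left (mem_ball_iff_norm.1 hy).le
          (mul_nonneg Φ.K_pos.le (Φ.rho_nonneg w))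
    _ = Φ.K * ε * Φ.rho w := by ring

theorem exists_dist_compMaps_T_le {x y : EuclideanSpace ℝ (Fin d)} (hx : x ∈ Φ.X)
    (hy : y ∈ Φ.X) :
    ∃ M : ℝ, ∀ w : List Φ.I, dist (compMaps Φ.T w x) (compMaps Φ.T w y) ≤ M * Φ.rho w := by
  refine Φ.hXconn.isPreconnected.induction₂
    (fun x y => ∃ M : ℝ, ∀ w : List Φ.I,
      dist (compMaps Φ.T w x) (compMaps Φ.T w y) ≤ M * Φ.rho w) ?_ ?_ ?_ hx hy
  · intro x hx
    obtain ⟨ε, hε, h⟩ := Φ.exists_ball_dist_compMaps_T_le (Φ.hXV hx)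
    filter_upwards [mem_nhdsWithin_of_mem_nhds (ball_mem_nhds x hε)] with y hy
    exact ⟨Φ.K * ε, fun w => (dist_comm _ _).trans_le (h y hy w)⟩
  · rintro x y z - - - ⟨M, hM⟩ ⟨N, hN⟩
    refine ⟨M + N, fun w => (dist_triangle _ (compMaps Φ.T w y) _).trans ?_⟩
    rw [add_mul]
    exact add_le_add (hM w) (hN w)
  · rintro x y - - ⟨M, hM⟩
    exact ⟨M, fun w => (dist_comm _ _).trans_le (hM w)⟩

/-- The cylinders `S_w(X)` have diameter at most a constant times `ρ(w)`. -/
theorem exists_dist_compMaps_S_le :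
    ∃ M : ℝ, ∀ x ∈ Φ.X, ∀ y ∈ Φ.X, ∀ w : List Φ.I,
      dist (compMaps Φ.S w x) (compMaps Φ.S w y) ≤ M * Φ.rho w := by
  obtain ⟨z, hz⟩ := Φ.hXconn.nonempty
  obtain ⟨M, hM⟩ : ∃ M : ℝ, ∀ x ∈ Φ.X, ∀ w : List Φ.I,
      dist (compMaps Φ.T w x) (compMaps Φ.T w z) ≤ M * Φ.rho w := by
    refine Φ.hXcompact.induction_on (p := fun A => ∃ M : ℝ, ∀ x ∈ A, ∀ w : List Φ.I,
      dist (compMaps Φ.T w x) (compMaps Φ.T w z) ≤ M * Φ.rho w) ⟨0, by simp⟩ ?_ ?_ ?_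
    · rintro A B hAB ⟨M, hM⟩
      exact ⟨M, fun x hx => hM x (hAB hx)⟩
    · rintro A B ⟨M, hM⟩ ⟨N, hN⟩
      refine ⟨max M N, fun x hx w => ?_⟩
      obtain hx | hx := hx
      · exact (hM x hx w).trans (mul_le_mul_of_nonneg_right (le_max_left _ _) (Φ.rho_nonneg w))
      · exact (hN x hx w).trans (mul_le_mul_of_nonneg_right (le_max_right _ _) (Φ.rho_nonneg w))
    · intro x hx
      obtain ⟨ε, hε, h⟩ := Φ.exists_ball_dist_compMaps_T_le (Φ.hXV hx)
      obtain ⟨M, hM⟩ := Φ.exists_dist_compMaps_T_le hx hz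
      refine ⟨ball x ε, mem_nhdsWithin_of_mem_nhds (ball_mem_nhds x hε), Φ.K * ε + M,
        fun y hy w => (dist_triangle _ (compMaps Φ.T w x) _).trans ?_⟩
      rw [add_mul]
      exact add_le_add (h y hy w) (hM w)
  refine ⟨M + M, fun x hx y hy w => ?_⟩
  rw [← Φ.compMaps_T_eq_S w hx, ← Φ.compMaps_T_eq_S w hy, add_mul]
  exact (dist_triangle_right _ _ _).trans (add_le_add (hM x hx w) (hM y hy w))

/-- The words `w` with `r < ρ(w) ≤ r·K/ρ_min`. -/
def wordsAtScale (r : ℝ) : Set (List Φ.I) :=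
  {w | r < Φ.rho w ∧ Φ.rho w ≤ r * Φ.K / (⨅ i : Φ.I, Φ.rho [i])}

theorem exists_forall_rho_le {r : ℝ} (hr : 0 < r) :
    ∃ N : ℕ, ∀ w : List Φ.I, N ≤ w.length → Φ.rho w ≤ r := by
  obtain ⟨N, hN⟩ := exists_pow_lt_of_lt_one (div_pos hr Φ.K_pos) Φ.hc1
  refine ⟨N, fun w hw => (Φ.rho_le_mul_pow w).trans ?_⟩
  rw [lt_div_iff₀ Φ.K_pos, mul_comm] at hN
  exact (mul_le_mul_of_nonneg_left (pow_le_pow_of_le_one Φ.hc0.le Φ.hc1.le hw)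
    Φ.K_pos.le).trans hN.le

theorem finite_wordsAtScale [Finite Φ.I] {r : ℝ} (hr : 0 < r) : (Φ.wordsAtScale r).Finite := by
  obtain ⟨N, hN⟩ := Φ.exists_forall_rho_le hr
  refine (List.finite_length_lt Φ.I N).subset fun w hw => ?_
  by_contra h
  exact (hN w (not_lt.1 h)).not_gt hw.1

theorem iInf_rho_pos [Finite Φ.I] [Nontrivial (EuclideanSpace ℝ (Fin d))] :
    0 < ⨅ i : Φ.I, Φ.rho [i] := by
  have := Φ.hInonempty
  obtain ⟨i, hi⟩ := exists_eq_ciInf_of_finite (f := fun i : Φ.I => Φ.rho [i])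
  rw [← hi]
  exact Φ.rho_singleton_pos i

/-- Every infinite word has an initial segment in `I(r)`. -/
theorem exists_ofFn_mem_wordsAtScale [Finite Φ.I] [Nontrivial (EuclideanSpace ℝ (Fin d))]
    (γ : ℕ → Φ.I) {r : ℝ} (hr : 0 < r) (hr1 : r < 1) :
    ∃ n : ℕ, List.ofFn (fun k : Fin n => γ k) ∈ Φ.wordsAtScale r := by
  have hex : ∃ n : ℕ, Φ.rho (List.ofFn fun k : Fin n => γ k) ≤ r := by
    obtain ⟨N, hN⟩ := Φ.exists_forall_rho_le hr
    exact ⟨N, hN _ (List.length_ofFn).ge⟩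
  classical
  obtain ⟨n, hn⟩ : ∃ n, Nat.find hex = n + 1 := by
    refine Nat.exists_eq_succ_of_ne_zero fun h => ?_
    have := Nat.find_spec hex
    rw [h, List.ofFn_zero, Φ.rho_nil] at this
    exact this.not_gt hr1
  have hle := Nat.find_spec hex
  have hgt := Nat.find_min hex (m := n) (by omega)
  rw [hn, List.ofFn_succ_last] at hle
  have hmul := (Φ.rho_mul_rho_le (List.ofFn fun k : Fin n => γ k) (γ n)).trans
    (mul_le_mul_of_nonneg_left hle Φ.K_pos.le)
  refine ⟨n, not_le.1 hgt, ?_⟩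
  rw [le_div_iff₀ Φ.iInf_rho_pos, mul_comm r]
  exact (mul_le_mul_of_nonneg_left (ciInf_le (Set.finite_range _).bddBelow (γ n))
    (Φ.rho_nonneg _)).trans hmul

theorem limitSet_subset [Finite Φ.I] [Nontrivial (EuclideanSpace ℝ (Fin d))] {r : ℝ}
    (hr : 0 < r) (hr1 : r < 1) :
    Φ.limitSet ⊆ ⋃ w : Φ.wordsAtScale r, compMaps Φ.S w '' Φ.X := by
  intro x hx
  obtain ⟨γ, hγ⟩ := mem_iUnion.1 hx
  rw [mem_iInter] at hγ
  obtain ⟨n, hn⟩ := Φ.exists_ofFn_mem_wordsAtScale γ hr hr1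
  refine mem_iUnion.2 ⟨⟨_, hn⟩, ?_⟩
  cases n with
  | zero =>
    obtain ⟨y, hy, rfl⟩ := hγ 0
    simp only [List.ofFn_zero]
    exact ⟨_, Φ.mapsTo_compMaps_S (List.ofFn fun k : Fin (0 + 1) => γ k) hy, rfl⟩
  | succ n => exact hγ n

theorem one_le_ncard_wordsAtScale [Finite Φ.I] [Nontrivial (EuclideanSpace ℝ (Fin d))] {r : ℝ}
    (hr : 0 < r) (hr1 : r < 1) : 1 ≤ (Φ.wordsAtScale r).ncard := by
  obtain ⟨i⟩ := Φ.hInonempty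
  obtain ⟨n, hn⟩ := Φ.exists_ofFn_mem_wordsAtScale (fun _ => i) hr hr1
  exact (Set.ncard_pos (Φ.finite_wordsAtScale hr)).2 ⟨_, hn⟩

/-- The cylinders of words in `I(r)` have diameter at most a constant times `r`. -/
theorem exists_ediam_le [Finite Φ.I] [Nontrivial (EuclideanSpace ℝ (Fin d))] :
    ∃ D : ℝ, 0 < D ∧ ∀ r : ℝ, 0 < r → ∀ w ∈ Φ.wordsAtScale r,
      ediam (compMaps Φ.S w '' Φ.X) ≤ ENNReal.ofReal (D * r) := by
  obtain ⟨M, hM⟩ := Φ.exists_dist_compMaps_S_le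
  have hm := Φ.iInf_rho_pos
  refine ⟨max M 1 * (Φ.K / ⨅ i : Φ.I, Φ.rho [i]),
    mul_pos (lt_max_of_lt_right one_pos) (div_pos Φ.K_pos hm), fun r hr w hw => ?_⟩
  refine ediam_le ?_
  rintro _ ⟨x, hx, rfl⟩ _ ⟨y, hy, rfl⟩
  rw [edist_dist]
  refine ENNReal.ofReal_le_ofReal ((hM x hx y hy w).trans ?_)
  calc M * Φ.rho w ≤ max M 1 * (r * Φ.K / ⨅ i : Φ.I, Φ.rho [i]) :=
        mul_le_mul (le_max_left _ _) hw.2 (Φ.rho_nonneg w) (zero_le_one.trans (le_max_right _ _))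
    _ = _ := by ring

/-- If `#I(r)·r^s` is not bounded below then the limit set is `s`-null. -/
theorem hausdorffMeasure_limitSet_eq_zero [Finite Φ.I]
    [Nontrivial (EuclideanSpace ℝ (Fin d))] {s : ℝ} (hs : 0 < s)
    (h : ∀ c : ℝ, 0 < c → ∃ r : ℝ, 0 < r ∧ r < 1 ∧
      ((Φ.wordsAtScale r).ncard : ℝ) < c * r ^ (-s)) :
    μH[s] Φ.limitSet = 0 := by
  obtain ⟨D, hD, hdiam⟩ := Φ.exists_ediam_le
  choose r hr hr1 hlt using fun n : ℕ => h (1 / ((n : ℝ) + 1)) Nat.one_div_pos_of_nat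
  have hlt' (n : ℕ) : ((Φ.wordsAtScale (r n)).ncard : ℝ) * r n ^ s < 1 / ((n : ℝ) + 1) := by
    have := hlt n
    rwa [Real.rpow_neg (hr n).le, ← div_eq_mul_inv,
      lt_div_iff₀ (Real.rpow_pos_of_pos (hr n) s)] at this
  have hrs : Tendsto (fun n => r n ^ s) atTop (𝓝 0) := by
    refine squeeze_zero (fun n => (Real.rpow_pos_of_pos (hr n) s).le) (fun n => ?_)
      tendsto_one_div_add_atTop_nhds_zero_nat
    refine (le_mul_of_one_le_left (Real.rpow_pos_of_pos (hr n) s).le ?_).trans (hlt' n).le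
    exact_mod_cast Φ.one_le_ncard_wordsAtScale (hr n) (hr1 n)
  have hr0 : Tendsto r atTop (𝓝 0) := by
    have := hrs.rpow_const (p := s⁻¹) (Or.inr (inv_pos.2 hs).le)
    rw [Real.zero_rpow (inv_pos.2 hs).ne'] at this
    exact this.congr fun n => Real.rpow_rpow_inv (hr n).le hs.ne'
  have := fun n => (Φ.finite_wordsAtScale (hr n)).fintype
  have hbound := MeasureTheory.Measure.hausdorffMeasure_le_liminf_sum s Φ.limitSet (l := atTop)
    (fun n => ENNReal.ofReal (D * r n))
    (by simpa using ENNReal.tendsto_ofReal (hr0.const_mul D))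
    (fun n (w : Φ.wordsAtScale (r n)) => compMaps Φ.S w '' Φ.X)
    (Eventually.of_forall fun n w => hdiam (r n) (hr n) w w.2)
    (Eventually.of_forall fun n => Φ.limitSet_subset (hr n) (hr1 n))
  refine le_antisymm (hbound.trans ?_) zero_le
  have hlim : Tendsto (fun n : ℕ => ENNReal.ofReal (D ^ s * (1 / ((n : ℝ) + 1)))) atTop (𝓝 0) := by
    simpa using ENNReal.tendsto_ofReal
      ((tendsto_one_div_add_atTop_nhds_zero_nat (𝕜 := ℝ)).const_mul (D ^ s))
  rw [← hlim.liminf_eq]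
  refine liminf_le_liminf (Eventually.of_forall fun n => ?_)
  calc ∑ w : Φ.wordsAtScale (r n), ediam (compMaps Φ.S w '' Φ.X) ^ s
      ≤ ∑ _w : Φ.wordsAtScale (r n), ENNReal.ofReal (D * r n) ^ s :=
        Finset.sum_le_sum fun w _ => ENNReal.rpow_le_rpow (hdiam (r n) (hr n) w w.2) hs.le
    _ = ENNReal.ofReal ((Φ.wordsAtScale (r n)).ncard * (D * r n) ^ s) := by
        rw [Finset.sum_const, Finset.card_univ, nsmul_eq_mul, ← Nat.card_eq_fintype_card,
          Nat.card_coe_set_eq, ENNReal.ofReal_mul (Nat.cast_nonneg _), ENNReal.ofReal_natCast,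
          ENNReal.ofReal_rpow_of_pos (mul_pos hD (hr n))]
    _ ≤ ENNReal.ofReal (D ^ s * (1 / ((n : ℝ) + 1))) := by
        refine ENNReal.ofReal_le_ofReal ?_
        rw [Real.mul_rpow hD.le (hr n).le, mul_left_comm]
        exact mul_le_mul_of_nonneg_left (hlt' n).le (Real.rpow_pos_of_pos hD s).le

end CIFS

/-- Saturation for finite subsystems: for `s < dim_H Λ` the number of words
with `r < ρ(w) ≤ r·K/ρ_min` is at least a constant times `r^{-s}`. -/
theorem finite_system_saturation {d : ℕ} (hd : 1 ≤ d) (Phi : CIFS d)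
    (hfin : Finite Phi.I) (s : ℝ) (hs : s < (dimH Phi.limitSet).toReal) :
    ∃ c : ℝ, 0 < c ∧ ∀ r : ℝ, 0 < r → r < 1 →
      c * r ^ (-s) ≤
        (Set.ncard {w : List Phi.I |
          r < Phi.rho w ∧ Phi.rho w ≤ r * Phi.K / (⨅ i : Phi.I, Phi.rho [i])} : ℝ) := by
  have : Nonempty (Fin d) := ⟨⟨0, hd⟩⟩
  change ∃ c : ℝ, 0 < c ∧ ∀ r : ℝ, 0 < r → r < 1 →
    c * r ^ (-s) ≤ ((Phi.wordsAtScale r).ncard : ℝ)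
  obtain hs0 | hs0 := le_or_gt s 0
  · refine ⟨1, one_pos, fun r hr hr1 => ?_⟩
    rw [one_mul]
    refine (Real.rpow_le_one hr.le hr1.le (neg_nonneg.2 hs0)).trans ?_
    exact_mod_cast Phi.one_le_ncard_wordsAtScale hr hr1
  · by_contra! h
    have htop : μH[s] Phi.limitSet = ⊤ := by
      have := hausdorffMeasure_of_lt_dimH (s := Phi.limitSet) (d := s.toNNReal)
        ((ENNReal.ofReal_lt_ofReal_iff (hs0.trans hs)).2 hs |>.trans_le ENNReal.ofReal_toReal_le)
      rwa [Real.coe_toNNReal s hs0.le] at this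
    rw [Phi.hausdorffMeasure_limitSet_eq_zero hs0 h] at htop
    exact ENNReal.zero_ne_top htop

end
end
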